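/- Let X be a Lévy process with positive sojourn time A_t, and fix c ∈ [0,1]. Then P(X_t > 0) = c for all t > 0 if and only if for all q, λ > 0 one has ∫_0^∞ e^{−qt} E[exp(−λ A_t)] dt = 1/( q · (1 + λ/q)^c ). -/

import Mathlib

open MeasureTheory ProbabilityTheory Real Set Filter

noncomputable section

variable {Ω : Type*} [MeasurableSpace Ω]

/-- The positive sojourn time of a process `X` up to time `t`:
`A_t := ∫_0^t 1{X_s > 0} ds`. -/
def sojourn (X : ℝ → Ω → ℝ) (t : ℝ) (ω : Ω) : ℝ :=
  ∫ s in (0:ℝ)..t, (if 0 < X s ω then (1:ℝ) else 0)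

/-- A real-valued Lévy process issued from the origin: càdlàg paths a.s.,
`X 0 = 0` a.s., stationary increments, and increments independent of the past. -/
structure IsLevyProcess (P : Measure Ω) (X : ℝ → Ω → ℝ) : Prop where
  measurable : ∀ t, Measurable (X t)
  start : ∀ᵐ ω ∂P, X 0 ω = 0
  cadlag : ∀ᵐ ω ∂P, ∀ t : ℝ, 0 ≤ t →
      ContinuousWithinAt (fun s => X s ω) (Set.Ici t) t ∧
      (0 < t → ∃ l : ℝ, Filter.Tendsto (fun s => X s ω) (nhdsWithin t (Set.Iio t)) (nhds l))
  stationary : ∀ s t : ℝ, 0 ≤ s → s ≤ t →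
      P.map (fun ω => X t ω - X s ω) = P.map (X (t - s))
  indep : ∀ s t : ℝ, 0 ≤ s → s ≤ t → ∀ (n : ℕ) (u : Fin n → ℝ),
      (∀ i, 0 ≤ u i ∧ u i ≤ s) →
      IndepFun (fun ω => X t ω - X s ω) (fun ω (i : Fin n) => X (u i) ω) P

/-- `f` is the characteristic function of a finite signed measure carried by `S`, presented as a
difference of two finite measures. -/
def IsSignedCharFun (S : Set ℝ) (f : ℝ → ℂ) : Prop :=
  ∃ M N : Measure ℝ, IsFiniteMeasure M ∧ IsFiniteMeasure N ∧ M Sᶜ = 0 ∧ N Sᶜ = 0 ∧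
    ∀ θ, f θ = charFun M θ - charFun N θ

lemma charFun_add_measure (M N : Measure ℝ) [IsFiniteMeasure M] [IsFiniteMeasure N] (θ : ℝ) :
    charFun (M + N) θ = charFun M θ + charFun N θ := by
  simp only [charFun_apply_real]
  rw [integral_add_measure] <;>
  exact (integrable_const (1 : ℝ)).mono (by fun_prop) (by simp [Complex.norm_exp])

lemma charFun_smul_measure (a : NNReal) (M : Measure ℝ) (θ : ℝ) :
    charFun (a • M) θ = (a : ℝ) * charFun M θ := by
  simp only [charFun_apply_real]
  rw [integral_smul_nnreal_measure]
  simp [NNReal.smul_def]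

lemma conv_compl_eq_zero {S : Set ℝ} (hS : MeasurableSet S)
    (hadd : ∀ x ∈ S, ∀ y ∈ S, x + y ∈ S) {M N : Measure ℝ} [IsFiniteMeasure M]
    [IsFiniteMeasure N] (hM : M Sᶜ = 0) (hN : N Sᶜ = 0) : (M ∗ N) Sᶜ = 0 := by
  rw [Measure.conv, Measure.map_apply (by fun_prop) hS.compl]
  refine measure_mono_null (t := (Sᶜ ×ˢ univ) ∪ (univ ×ˢ Sᶜ)) ?_ ?_
  · rintro ⟨x, y⟩ hxy
    by_contra h
    simp only [mem_union, mem_prod, mem_compl_iff, mem_univ, and_true, true_and, not_or,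
      not_not] at h
    exact hxy (hadd x h.1 y h.2)
  · simp [Measure.prod_prod, hM, hN]

namespace IsSignedCharFun

variable {S : Set ℝ} {f g : ℝ → ℂ}

lemma of_charFun (M : Measure ℝ) [IsFiniteMeasure M] (hM : M Sᶜ = 0) :
    IsSignedCharFun S (charFun M) :=
  ⟨M, 0, inferInstance, inferInstance, hM, by simp, by simp⟩

lemma add (hf : IsSignedCharFun S f) (hg : IsSignedCharFun S g) :
    IsSignedCharFun S (fun θ => f θ + g θ) := by
  obtain ⟨M, N, hM, hN, hMS, hNS, h⟩ := hf
  obtain ⟨M', N', hM', hN', hMS', hNS', h'⟩ := hg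
  refine ⟨M + M', N + N', inferInstance, inferInstance, by simp [hMS, hMS'],
    by simp [hNS, hNS'], fun θ => ?_⟩
  simp only [h, h', charFun_add_measure]
  ring

lemma neg (hf : IsSignedCharFun S f) : IsSignedCharFun S (fun θ => -f θ) := by
  obtain ⟨M, N, hM, hN, hMS, hNS, h⟩ := hf
  exact ⟨N, M, hN, hM, hNS, hMS, fun θ => by simp only [h]; ring⟩

lemma mul (hS : MeasurableSet S) (hadd : ∀ x ∈ S, ∀ y ∈ S, x + y ∈ S)
    (hf : IsSignedCharFun S f) (hg : IsSignedCharFun S g) :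
    IsSignedCharFun S (fun θ => f θ * g θ) := by
  obtain ⟨M, N, hM, hN, hMS, hNS, h⟩ := hf
  obtain ⟨M', N', hM', hN', hMS', hNS', h'⟩ := hg
  refine ⟨M ∗ M' + N ∗ N', M ∗ N' + N ∗ M', inferInstance, inferInstance, ?_, ?_, fun θ => ?_⟩
  · simp [conv_compl_eq_zero hS hadd, *]
  · simp [conv_compl_eq_zero hS hadd, *]
  · simp only [h, h', charFun_add_measure, charFun_conv]
    ring

/-- A function that is at once a signed characteristic function of `S` and of `Sᶜ` vanishes. -/
lemma eq_zero (hf : IsSignedCharFun S f) (hf' : IsSignedCharFun Sᶜ f)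
    (θ : ℝ) : f θ = 0 := by
  obtain ⟨M, N, hM, hN, hMS, hNS, h⟩ := hf
  obtain ⟨M', N', hM', hN', hMS', hNS', h'⟩ := hf'
  rw [compl_compl] at hMS' hNS'
  have key : M + N' = M' + N := by
    refine Measure.ext_of_charFun (funext fun θ => ?_)
    rw [charFun_add_measure, charFun_add_measure]
    linear_combination (h' θ) - h θ
  have hMN : M = N := by
    have := congrArg (fun m => m.restrict S) key
    simp only [Measure.restrict_add] at this
    rw [Measure.restrict_eq_zero.2 hMS', Measure.restrict_eq_zero.2 hNS', add_zero,
      zero_add] at this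
    rwa [Measure.restrict_eq_self_of_ae_mem (show ∀ᵐ x ∂M, x ∈ S from hMS),
      Measure.restrict_eq_self_of_ae_mem (show ∀ᵐ x ∂N, x ∈ S from hNS)] at this
  rw [h, hMN, sub_self]

end IsSignedCharFun

lemma exists_measure_charFun_pow {S : Set ℝ} (hS : MeasurableSet S)
    (hadd : ∀ x ∈ S, ∀ y ∈ S, x + y ∈ S) (M : Measure ℝ) [IsFiniteMeasure M] (hM : M Sᶜ = 0)
    (n : ℕ) : ∃ N : Measure ℝ, IsFiniteMeasure N ∧ N Sᶜ = 0 ∧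
      ∀ θ, charFun N θ = charFun M θ ^ (n + 1) := by
  induction n with
  | zero => exact ⟨M, inferInstance, hM, by simp⟩
  | succ n ih =>
    obtain ⟨N, hN, hNS, h⟩ := ih
    refine ⟨N ∗ M, inferInstance, conv_compl_eq_zero hS hadd hNS hM, fun θ => ?_⟩
    rw [charFun_conv, h, pow_succ _ (n + 1)]

lemma exists_measure_hasSum_charFun {S : Set ℝ} (hS : MeasurableSet S)
    (hadd : ∀ x ∈ S, ∀ y ∈ S, x + y ∈ S) (M : Measure ℝ) [IsFiniteMeasure M] (hM : M Sᶜ = 0)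
    (a : ℕ → NNReal) (ha : Summable fun n => (a n : ℝ) * M.real univ ^ (n + 1)) :
    ∃ N : Measure ℝ, IsFiniteMeasure N ∧ N Sᶜ = 0 ∧
      ∀ θ, HasSum (fun n => ((a n : ℝ) : ℂ) * charFun M θ ^ (n + 1)) (charFun N θ) := by
  choose N hN hNS h using exists_measure_charFun_pow hS hadd M hM
  have hmass : ∀ n, (N n).real univ = M.real univ ^ (n + 1) := fun n => by
    have := h n 0
    simp only [charFun_zero] at this
    exact_mod_cast this
  have hfin : IsFiniteMeasure (Measure.sum fun n => a n • N n) := by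
    refine ⟨?_⟩
    rw [Measure.sum_apply _ MeasurableSet.univ]
    have : ∀ n, (a n • N n) univ = ENNReal.ofReal ((a n : ℝ) * M.real univ ^ (n + 1)) := by
      intro n
      rw [← hmass, ENNReal.ofReal_mul (by positivity), ofReal_measureReal]
      simp [Measure.smul_apply]
    simp_rw [this]
    rw [← ENNReal.ofReal_tsum_of_nonneg (fun n => by positivity) ha]
    exact ENNReal.ofReal_lt_top
  refine ⟨Measure.sum fun n => a n • N n, hfin, ?_, fun θ => ?_⟩
  · rw [Measure.sum_apply _ hS.compl]
    simp [hNS]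
  · have h_integrable : Integrable (fun x : ℝ => Complex.exp (θ * x * Complex.I))
        (Measure.sum fun n => a n • N n) :=
      (integrable_const (1 : ℝ)).mono (by fun_prop) (by simp [Complex.norm_exp])
    have := hasSum_integral_measure h_integrable
    simp only [← charFun_apply_real, charFun_smul_measure, h] at this
    exact this

lemma IsSignedCharFun.exp_sub_one {S : Set ℝ} (hS : MeasurableSet S)
    (hadd : ∀ x ∈ S, ∀ y ∈ S, x + y ∈ S) (M : Measure ℝ) [IsFiniteMeasure M] (hM : M Sᶜ = 0)
    (ε : ℝ) : IsSignedCharFun S (fun θ => Complex.exp (ε * charFun M θ) - 1) := by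
  set a : ℕ → ℝ := fun n => ε ^ (n + 1) / (n + 1).factorial with ha
  have hsum : Summable fun n => |a n| * M.real univ ^ (n + 1) := by
    have := (summable_nat_add_iff 1).2 (Real.summable_pow_div_factorial (|ε| * M.real univ))
    refine this.congr fun n => ?_
    simp only [ha, abs_div, abs_pow, Nat.abs_cast, mul_pow]
    ring
  obtain ⟨N₁, hN₁, hS₁, h₁⟩ := exists_measure_hasSum_charFun hS hadd M hM
    (fun n => (a n).toNNReal) (hsum.of_nonneg_of_le (fun n => by positivity) fun n => by
      gcongr; simp [le_abs_self])
  obtain ⟨N₂, hN₂, hS₂, h₂⟩ := exists_measure_hasSum_charFun hS hadd M hM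
    (fun n => (-a n).toNNReal) (hsum.of_nonneg_of_le (fun n => by positivity) fun n => by
      gcongr; simp [neg_le_abs])
  refine ⟨N₁, N₂, hN₁, hN₂, hS₁, hS₂, fun θ => ?_⟩
  refine HasSum.unique ?_ ((h₁ θ).sub (h₂ θ))
  have h := NormedSpace.expSeries_div_hasSum_exp ((ε : ℂ) * charFun M θ)
  rw [← Complex.exp_eq_exp_ℂ] at h
  have h' := (hasSum_nat_add_iff' 1).2 h
  simp only [Finset.range_one, Finset.sum_singleton, pow_zero, Nat.factorial_zero, Nat.cast_one,
    div_one] at h'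
  refine h'.congr_fun (fun n => ?_)
  have : ((a n).toNNReal : ℝ) - ((-a n).toNNReal : ℝ) = a n := by
    simp [Real.coe_toNNReal']
  rw [← sub_mul, ← Complex.ofReal_sub, this, ha]
  push_cast
  ring

/-- The weight `(e^{-qt} - e^{-(q+l)t}) / t`. -/
def frullaniWeight (q l t : ℝ) : ℝ := (Real.exp (-q * t) - Real.exp (-(q + l) * t)) / t

lemma measurable_frullaniWeight (q l : ℝ) : Measurable (frullaniWeight q l) := by
  unfold frullaniWeight
  fun_prop

lemma frullaniWeight_nonneg {q l t : ℝ} (hl : 0 ≤ l) (ht : 0 < t) : 0 ≤ frullaniWeight q l t := by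
  refine div_nonneg (sub_nonneg.2 (Real.exp_le_exp.2 ?_)) ht.le
  nlinarith

lemma frullaniWeight_le {q l t : ℝ} (ht : 0 < t) :
    frullaniWeight q l t ≤ l * Real.exp (-q * t) := by
  rw [frullaniWeight, div_le_iff₀ ht]
  have h : Real.exp (-(q + l) * t) = Real.exp (-q * t) * Real.exp (-(l * t)) := by
    rw [← Real.exp_add]; ring_nf
  have := Real.add_one_le_exp (-(l * t))
  rw [h]
  nlinarith [Real.exp_pos (-q * t)]

lemma integrableOn_exp_neg_mul {q : ℝ} (hq : 0 < q) :
    IntegrableOn (fun t => Real.exp (-q * t)) (Ioi 0) :=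
  exp_neg_integrableOn_Ioi 0 hq

lemma integrableOn_frullaniWeight {q l : ℝ} (hq : 0 < q) (hl : 0 ≤ l) :
    IntegrableOn (frullaniWeight q l) (Ioi 0) := by
  refine ((integrableOn_exp_neg_mul hq).const_mul l).mono'
    (measurable_frullaniWeight q l).aestronglyMeasurable ?_
  filter_upwards [ae_restrict_mem measurableSet_Ioi] with t ht
  rw [Real.norm_of_nonneg (frullaniWeight_nonneg hl ht)]
  exact frullaniWeight_le ht

lemma integrableOn_ofReal_mul {w : ℝ → ℝ} (hw : IntegrableOn w (Ioi 0)) {φ : ℝ → ℂ}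
    (hφ : Measurable φ) (hφ1 : ∀ t, ‖φ t‖ ≤ 1) :
    IntegrableOn (fun t => (w t : ℂ) * φ t) (Ioi 0) :=
  hw.ofReal.mul_bdd hφ.aestronglyMeasurable (.of_forall hφ1)

/-- The resolvent equation of a bounded multiplicative function on the half-line. -/
lemma laplace_resolvent {φ : ℝ → ℂ} (hφ : Measurable φ) (hφ1 : ∀ t, ‖φ t‖ ≤ 1)
    (hmul : ∀ s t, 0 ≤ s → 0 ≤ t → φ (s + t) = φ s * φ t) {q l : ℝ} (hq : 0 < q) (hl : 0 ≤ l) :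
    (∫ t in Ioi (0 : ℝ), (Real.exp (-q * t) : ℂ) * φ t) -
      ∫ t in Ioi (0 : ℝ), (Real.exp (-(q + l) * t) : ℂ) * φ t =
    l * ((∫ t in Ioi (0 : ℝ), (Real.exp (-(q + l) * t) : ℂ) * φ t) *
      ∫ t in Ioi (0 : ℝ), (Real.exp (-q * t) : ℂ) * φ t) := by
  have hq' : 0 < q + l := by linarith
  have i1 := integrableOn_ofReal_mul (integrableOn_exp_neg_mul hq) hφ hφ1
  have i2 := integrableOn_ofReal_mul (integrableOn_exp_neg_mul hq') hφ hφ1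
  have h := integral_posConvolution i2 i1 (ContinuousLinearMap.mul ℝ ℂ)
  simp only [ContinuousLinearMap.mul_apply'] at h
  rw [← h, ← integral_const_mul, ← integral_sub i1 i2]
  refine setIntegral_congr_fun measurableSet_Ioi fun x hx => ?_
  have hx : 0 < x := hx
  have e1 : ∫ t in (0 : ℝ)..x, (Real.exp (-(q + l) * t) : ℂ) * φ t *
      ((Real.exp (-q * (x - t)) : ℂ) * φ (x - t)) =
      ∫ t in (0 : ℝ)..x, ((Real.exp (-q * x) * Real.exp (-l * t) : ℝ) : ℂ) * φ x := by
    refine intervalIntegral.integral_congr fun t ht => ?_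
    rw [uIcc_of_le hx.le] at ht
    have := hmul t (x - t) ht.1 (by linarith [ht.2])
    rw [add_sub_cancel] at this
    have e : Real.exp (-q * x) * Real.exp (-l * t) =
        Real.exp (-(q + l) * t) * Real.exp (-q * (x - t)) := by
      rw [← Real.exp_add, ← Real.exp_add]; ring_nf
    simp only [this, e]
    push_cast
    ring
  have e2 : l * ∫ t in (0 : ℝ)..x, Real.exp (-l * t) = 1 - Real.exp (-l * x) := by
    rcases hl.eq_or_lt with rfl | hl
    · simp
    · rw [intervalIntegral.integral_comp_mul_left (fun t => Real.exp t) (by linarith : -l ≠ 0),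
        integral_exp]
      simp only [smul_eq_mul, mul_zero, Real.exp_zero]
      field_simp
      ring
  have e3 : Real.exp (-(q + l) * x) = Real.exp (-q * x) * Real.exp (-l * x) := by
    rw [← Real.exp_add]; ring_nf
  rw [e1, intervalIntegral.integral_mul_const, intervalIntegral.integral_ofReal,
    intervalIntegral.integral_const_mul]
  have e4 : (l : ℂ) * ((∫ t in (0 : ℝ)..x, Real.exp (-l * t) : ℝ) : ℂ) =
    1 - (Real.exp (-l * x) : ℂ) := by exact_mod_cast e2
  rw [e3]
  push_cast at e4 ⊢
  linear_combination (-Complex.exp (-q * x) * φ x) * e4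

lemma hasDerivAt_integral_frullaniWeight {φ : ℝ → ℂ} (hφ : Measurable φ) (hφ1 : ∀ t, ‖φ t‖ ≤ 1)
    {q l : ℝ} (hq : 0 < q) (hl : 0 ≤ l) :
    HasDerivAt (fun l => ∫ t in Ioi (0 : ℝ), (frullaniWeight q l t : ℂ) * φ t)
      (∫ t in Ioi (0 : ℝ), (Real.exp (-(q + l) * t) : ℂ) * φ t) l := by
  have hs : Ioi (-(q / 2)) ∈ nhds l := Ioi_mem_nhds (by linarith)
  refine (hasDerivAt_integral_of_dominated_loc_of_deriv_le (μ := volume.restrict (Ioi (0 : ℝ)))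
    (F := fun l t => (frullaniWeight q l t : ℂ) * φ t)
    (F' := fun l t => (Real.exp (-(q + l) * t) : ℂ) * φ t)
    (bound := fun t => Real.exp (-(q / 2) * t)) hs ?_ ?_ ?_ ?_ ?_ ?_).2
  · refine .of_forall fun l => ?_
    have := measurable_frullaniWeight q l
    exact (by fun_prop : Measurable fun t => (frullaniWeight q l t : ℂ) * φ t).aestronglyMeasurable
  · exact integrableOn_ofReal_mul (integrableOn_frullaniWeight hq hl) hφ hφ1
  · exact (by fun_prop :
      Measurable fun t => (Real.exp (-(q + l) * t) : ℂ) * φ t).aestronglyMeasurable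
  · filter_upwards [ae_restrict_mem measurableSet_Ioi] with t ht x hx
    rw [norm_mul, Complex.norm_real, Real.norm_of_nonneg (Real.exp_pos _).le]
    have ht : 0 < t := ht
    have hx : -(q / 2) < x := hx
    calc _ ≤ Real.exp (-(q + x) * t) * 1 := by gcongr; exact hφ1 t
      _ ≤ _ := by
        rw [mul_one]
        exact Real.exp_le_exp.2 (by nlinarith)
  · exact integrableOn_exp_neg_mul (half_pos hq)
  · filter_upwards [ae_restrict_mem measurableSet_Ioi] with t ht x hx
    have ht : 0 < t := ht
    refine HasDerivAt.mul_const (HasDerivAt.ofReal_comp ?_) (φ t)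
    have h1 : HasDerivAt (fun y => -(q + y) * t) (-1 * t) x :=
      (((hasDerivAt_id x).const_add q).neg).mul_const t
    have h2 := (h1.exp.const_sub (Real.exp (-q * t))).div_const t
    convert! h2 using 1
    field_simp

/-- The logarithm of `1 + l G_q`, where `G_q` is the Laplace transform at `q` of a bounded
multiplicative function. -/
lemma one_add_mul_laplace_eq_exp {φ : ℝ → ℂ} (hφ : Measurable φ) (hφ1 : ∀ t, ‖φ t‖ ≤ 1)
    (hmul : ∀ s t, 0 ≤ s → 0 ≤ t → φ (s + t) = φ s * φ t) {q l : ℝ} (hq : 0 < q) (hl : 0 ≤ l) :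
    1 + l * ∫ t in Ioi (0 : ℝ), (Real.exp (-q * t) : ℂ) * φ t =
      Complex.exp (∫ t in Ioi (0 : ℝ), (frullaniWeight q l t : ℂ) * φ t) := by
  set G := ∫ t in Ioi (0 : ℝ), (Real.exp (-q * t) : ℂ) * φ t with hG
  set N : ℝ → ℂ := fun l => ∫ t in Ioi (0 : ℝ), (frullaniWeight q l t : ℂ) * φ t with hN
  have hd : ∀ x, 0 ≤ x → HasDerivAt (fun x : ℝ => (1 + x * G) * Complex.exp (-N x)) 0 x := by
    intro x hx
    have h1 := (hasDerivAt_integral_frullaniWeight hφ hφ1 hq hx).neg.cexp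
    have h2 : HasDerivAt (fun x : ℝ => 1 + (x : ℂ) * G) (1 * G) x :=
      ((Complex.ofRealCLM.hasDerivAt (x := x)).mul_const G).const_add 1
    convert! h2.mul h1 using 1
    have := laplace_resolvent hφ hφ1 hmul hq hx
    rw [← hG] at this
    simp only [Pi.neg_apply]
    linear_combination (-Complex.exp (-N x)) * this
  have hc := constant_of_has_deriv_right_zero (a := 0) (b := l)
    (f := fun x : ℝ => (1 + x * G) * Complex.exp (-N x))
    (fun x hx => (hd x hx.1).continuousAt.continuousWithinAt)
    (fun x hx => (hd x hx.1).hasDerivWithinAt) l ⟨hl, le_rfl⟩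
  have h0 : N 0 = 0 := by simp [hN, frullaniWeight]
  simp only [h0, Complex.ofReal_zero, zero_mul, add_zero, neg_zero, Complex.exp_zero,
    mul_one] at hc
  rw [Complex.exp_neg, ← div_eq_mul_inv, div_eq_one_iff_eq (Complex.exp_ne_zero _)] at hc
  exact hc

lemma integral_exp_neg_mul_Ioi {q : ℝ} (hq : 0 < q) :
    ∫ t in Ioi (0 : ℝ), Real.exp (-q * t) = 1 / q := by
  rw [integral_exp_mul_Ioi (by linarith : -q < 0) 0]
  simp

/-- Frullani's integral. -/
lemma integral_frullaniWeight {q l : ℝ} (hq : 0 < q) (hl : 0 ≤ l) :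
    ∫ t in Ioi (0 : ℝ), frullaniWeight q l t = Real.log (1 + l / q) := by
  have h := one_add_mul_laplace_eq_exp (φ := fun _ => 1) measurable_const (by simp) (by simp)
    hq hl
  simp only [mul_one] at h
  rw [integral_complex_ofReal, integral_complex_ofReal, integral_exp_neg_mul_Ioi hq] at h
  have h' : 1 + l * (1 / q) = Real.exp (∫ t in Ioi (0 : ℝ), frullaniWeight q l t) := by
    exact_mod_cast h
  rw [mul_one_div] at h'
  rw [h', Real.log_exp]

lemma integral_cexp_mul_eq_zero_of_moments {h : ℝ → ℝ} (hh : IntegrableOn h (Ioi 0))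
    (hn : ∀ n : ℕ, ∫ t in Ioi (0 : ℝ), Real.exp (-t) ^ n * h t = 0) (θ : ℝ) :
    ∫ t in Ioi (0 : ℝ), Complex.exp (θ * Real.exp (-t) * Complex.I) * h t = 0 := by
  set F : ℕ → ℝ → ℂ := fun n t =>
    (θ * Complex.I) ^ n / (n.factorial : ℂ) * ((Real.exp (-t) ^ n * h t : ℝ) : ℂ) with hF
  have hle : ∀ n : ℕ, ∀ᵐ t ∂volume.restrict (Ioi (0 : ℝ)), ‖Real.exp (-t) ^ n * h t‖ ≤ ‖h t‖ := by
    intro n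
    filter_upwards [ae_restrict_mem measurableSet_Ioi] with t ht
    have ht : 0 < t := ht
    rw [norm_mul, norm_pow, Real.norm_of_nonneg (Real.exp_pos _).le]
    exact mul_le_of_le_one_left (norm_nonneg _)
      (pow_le_one₀ (Real.exp_pos _).le (Real.exp_le_one_iff.2 (by linarith)))
  have h_integrable : ∀ n : ℕ, IntegrableOn (fun t => Real.exp (-t) ^ n * h t) (Ioi 0) := fun n =>
    hh.norm.mono' ((by fun_prop : Measurable fun t : ℝ =>
      Real.exp (-t) ^ n).aestronglyMeasurable.mul hh.aestronglyMeasurable) (hle n)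
  have hsum : Summable fun n => ∫ t in Ioi (0 : ℝ), ‖F n t‖ := by
    refine ((Real.summable_pow_div_factorial |θ|).mul_right
      (∫ t in Ioi (0 : ℝ), ‖h t‖)).of_nonneg_of_le (fun n => by positivity) fun n => ?_
    simp only [hF, norm_mul, norm_div, norm_pow, Complex.norm_real, Complex.norm_I, mul_one,
      Complex.norm_natCast, Real.norm_eq_abs θ]
    rw [integral_const_mul]
    refine mul_le_mul_of_nonneg_left ?_ (by positivity)
    refine integral_mono_ae ?_ hh.norm ?_
    · simpa [norm_mul, norm_pow] using (h_integrable n).norm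
    · filter_upwards [hle n] with t ht
      simpa [norm_mul, norm_pow] using ht
  have key := hasSum_integral_of_summable_integral_norm (μ := volume.restrict (Ioi (0 : ℝ)))
    (F := F) (fun n => (h_integrable n).ofReal.const_mul _) hsum
  have hz : ∀ n, ∫ t in Ioi (0 : ℝ), F n t = 0 := fun n => by
    simp only [hF]
    rw [integral_const_mul, integral_complex_ofReal, hn, Complex.ofReal_zero, mul_zero]
  simp only [hz] at key
  rw [← key.unique hasSum_zero]
  refine integral_congr_ae (.of_forall fun t => ?_)
  have := (NormedSpace.expSeries_div_hasSum_exp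
    ((θ : ℂ) * Real.exp (-t) * Complex.I)).mul_right (h t : ℂ)
  rw [← Complex.exp_eq_exp_ℂ] at this
  simp only
  rw [← this.tsum_eq]
  refine tsum_congr fun n => ?_
  simp only [hF]
  push_cast
  ring

/-- A nonnegative integrable function on the half-line is determined by its Laplace transform at
the natural numbers. -/
lemma ae_eq_of_laplace_nat_eq {f g : ℝ → ℝ} (hf : Measurable f) (hg : Measurable g)
    (hf0 : ∀ t, 0 < t → 0 ≤ f t) (hg0 : ∀ t, 0 < t → 0 ≤ g t)
    (hfi : IntegrableOn f (Ioi 0)) (hgi : IntegrableOn g (Ioi 0))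
    (h : ∀ n : ℕ, ∫ t in Ioi (0 : ℝ), Real.exp (-t) ^ n * f t =
      ∫ t in Ioi (0 : ℝ), Real.exp (-t) ^ n * g t) :
    ∀ᵐ t ∂volume.restrict (Ioi (0 : ℝ)), f t = g t := by
  have hbd : ∀ {k : ℝ → ℝ}, IntegrableOn k (Ioi 0) → ∀ n : ℕ,
      IntegrableOn (fun t => Real.exp (-t) ^ n * k t) (Ioi 0) := by
    intro k hk n
    refine hk.bdd_mul (c := 1) (by fun_prop : Measurable fun t : ℝ =>
      Real.exp (-t) ^ n).aestronglyMeasurable ?_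
    filter_upwards [ae_restrict_mem measurableSet_Ioi] with t ht
    have ht : 0 < t := ht
    rw [norm_pow, Real.norm_of_nonneg (Real.exp_pos _).le]
    exact pow_le_one₀ (Real.exp_pos _).le (Real.exp_le_one_iff.2 (by linarith))
  have hz := integral_cexp_mul_eq_zero_of_moments (hfi.sub hgi) (fun n => by
    simp only [Pi.sub_apply, mul_sub]
    rw [integral_sub (hbd hfi n) (hbd hgi n), h, sub_self])
  set mf := (volume.restrict (Ioi (0 : ℝ))).withDensity (fun t => ENNReal.ofReal (f t)) with hmf
  set mg := (volume.restrict (Ioi (0 : ℝ))).withDensity (fun t => ENNReal.ofReal (g t)) with hmg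
  have finf : IsFiniteMeasure mf := isFiniteMeasure_withDensity_ofReal hfi.2
  have fing : IsFiniteMeasure mg := isFiniteMeasure_withDensity_ofReal hgi.2
  have hemb : MeasurableEmbedding (fun t : ℝ => Real.exp (-t)) :=
    (by fun_prop : Continuous fun t : ℝ => Real.exp (-t)).measurableEmbedding
      (fun a b hab => neg_injective (Real.exp_injective hab))
  have hcf : ∀ (k : ℝ → ℝ), Measurable k → (∀ t, 0 < t → 0 ≤ k t) → ∀ θ : ℝ,
      charFun (((volume.restrict (Ioi (0 : ℝ))).withDensity
        (fun t => ENNReal.ofReal (k t))).map (fun t => Real.exp (-t))) θ =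
      ∫ t in Ioi (0 : ℝ), Complex.exp (θ * Real.exp (-t) * Complex.I) * k t := by
    intro k hk hk0 θ
    rw [charFun_apply_real, hemb.integral_map, integral_withDensity_eq_integral_toReal_smul
      (by fun_prop) (by simp)]
    refine setIntegral_congr_fun measurableSet_Ioi fun t ht => ?_
    simp [ENNReal.toReal_ofReal (hk0 t ht), mul_comm]
  have hmap : mf.map (fun t => Real.exp (-t)) = mg.map (fun t => Real.exp (-t)) := by
    refine Measure.ext_of_charFun (funext fun θ => ?_)
    rw [hcf f hf hf0, hcf g hg hg0, ← sub_eq_zero, ← integral_sub, ← hz θ]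
    · refine integral_congr_ae (.of_forall fun t => ?_)
      simp [mul_sub]
    all_goals
      refine Integrable.bdd_mul (c := 1) (Integrable.ofReal ‹_›)
        (by fun_prop : Measurable fun t : ℝ =>
          Complex.exp (θ * Real.exp (-t) * Complex.I)).aestronglyMeasurable
        (.of_forall fun t => ?_)
      rw [← Complex.ofReal_mul, Complex.norm_exp_ofReal_mul_I]
  have hmm : mf = mg := by
    rw [← hemb.comap_map mf, hmap, hemb.comap_map]
  have := (withDensity_eq_iff_of_sigmaFinite (by fun_prop) (by fun_prop)).1 hmm
  filter_upwards [this, ae_restrict_mem measurableSet_Ioi] with t ht ht0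
  exact (ENNReal.ofReal_eq_ofReal_iff (hf0 t ht0) (hg0 t ht0)).1 ht

lemma frullaniWeight_natCast (n : ℕ) (t : ℝ) :
    frullaniWeight (n + 1) 1 t = Real.exp (-t) ^ n * frullaniWeight 1 1 t := by
  rw [frullaniWeight, frullaniWeight, ← Real.exp_nat_mul, mul_div_assoc', mul_sub,
    ← Real.exp_add, ← Real.exp_add]
  ring_nf

lemma frullaniWeight_pos {q l t : ℝ} (hl : 0 < l) (ht : 0 < t) : 0 < frullaniWeight q l t := by
  refine div_pos (sub_pos.2 (Real.exp_lt_exp.2 ?_)) ht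
  nlinarith

lemma ae_eq_const_of_integral_frullaniWeight {p : ℝ → ℝ} (hp : Measurable p) (hp0 : ∀ t, 0 ≤ p t)
    (hp1 : ∀ t, p t ≤ 1) {c : ℝ} (hc : 0 ≤ c)
    (h : ∀ q l : ℝ, 0 < q → 0 < l → ∫ t in Ioi (0 : ℝ), frullaniWeight q l t * p t =
      c * ∫ t in Ioi (0 : ℝ), frullaniWeight q l t) :
    ∀ᵐ t ∂volume.restrict (Ioi (0 : ℝ)), p t = c := by
  have hw := integrableOn_frullaniWeight one_pos (zero_le_one' ℝ)
  have hm := measurable_frullaniWeight 1 1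
  have key := ae_eq_of_laplace_nat_eq (f := fun t => frullaniWeight 1 1 t * p t)
    (g := fun t => frullaniWeight 1 1 t * c) (by fun_prop) (by fun_prop)
    (fun t ht => mul_nonneg (frullaniWeight_nonneg zero_le_one ht) (hp0 t))
    (fun t ht => mul_nonneg (frullaniWeight_nonneg zero_le_one ht) hc)
    (hw.mul_bdd (c := 1) hp.aestronglyMeasurable
      (.of_forall fun t => by rw [Real.norm_of_nonneg (hp0 t)]; exact hp1 t))
    (hw.mul_const c) (fun n => by
      simp_rw [← mul_assoc, ← frullaniWeight_natCast]
      rw [h _ _ (by positivity) one_pos, integral_mul_const, mul_comm])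
  filter_upwards [key, ae_restrict_mem measurableSet_Ioi] with t ht ht0
  exact mul_left_cancel₀ (frullaniWeight_pos one_pos ht0).ne' ht

lemma measurable_uncurry_of_rightContinuous {Ω : Type*} {m : MeasurableSpace Ω} {Z : ℝ → Ω → ℝ}
    (hZ : ∀ t, Measurable (Z t))
    (hc : ∀ ω t, ContinuousWithinAt (fun s => Z s ω) (Ici t) t) :
    Measurable (Function.uncurry Z) := by
  set x : ℕ → ℝ → ℝ := fun n t => (⌊t * (n + 1)⌋ + 1 : ℝ) / (n + 1) with hx
  refine measurable_of_tendsto_metrizable (f := fun n (y : ℝ × Ω) => Z (x n y.1) y.2)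
    (fun n => ?_) ?_
  · have h1 : Measurable fun y : Ω × ℤ => Z ((y.2 + 1 : ℝ) / (n + 1)) y.1 :=
      measurable_from_prod_countable_left fun k => hZ ((k + 1 : ℝ) / (n + 1))
    exact h1.comp (f := fun y : ℝ × Ω => (y.2, ⌊y.1 * (n + 1)⌋)) (by fun_prop)
  · rw [tendsto_pi_nhds]
    rintro ⟨t, ω⟩
    have hle : ∀ n, t ≤ x n t := fun n => by
      rw [hx, le_div_iff₀ (by positivity)]
      exact (Int.lt_floor_add_one _).le
    have hle' : ∀ n, x n t ≤ t + 1 / ((n : ℝ) + 1) := fun n => by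
      rw [hx, div_le_iff₀ (by positivity), add_mul, one_div_mul_cancel (by positivity)]
      gcongr
      exact Int.floor_le _
    refine (hc ω t).tendsto.comp (tendsto_nhdsWithin_iff.2 ⟨?_, .of_forall hle⟩)
    refine tendsto_of_tendsto_of_tendsto_of_le_of_le tendsto_const_nhds ?_ hle hle'
    simpa using tendsto_const_nhds.add (tendsto_one_div_add_atTop_nhds_zero_nat (𝕜 := ℝ))

/-- A Lévy process all of whose paths are right-continuous. -/
structure IsRightContLevy (P : Measure Ω) (X : ℝ → Ω → ℝ) : Prop where
  measurable : ∀ t, Measurable (X t)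
  rightCont : ∀ ω t, ContinuousWithinAt (fun s => X s ω) (Ici t) t
  stationary : ∀ s t : ℝ, 0 ≤ s → s ≤ t →
      P.map (fun ω => X t ω - X s ω) = P.map (X (t - s))
  indep : ∀ s t : ℝ, 0 ≤ s → s ≤ t → ∀ (n : ℕ) (u : Fin n → ℝ),
      (∀ i, 0 ≤ u i ∧ u i ≤ s) →
      IndepFun (fun ω => X t ω - X s ω) (fun ω (i : Fin n) => X (u i) ω) P

lemma continuousWithinAt_Ici_comp_monotone {f k : ℝ → ℝ} {t : ℝ} (hk : Continuous k)
    (hm : Monotone k) (hf : ContinuousWithinAt f (Ici (k t)) (k t)) :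
    ContinuousWithinAt (fun s => f (k s)) (Ici t) t :=
  hf.comp hk.continuousWithinAt (fun _ hs => hm hs)

/-- A Lévy process is indistinguishable on `[0, ∞)` from one with right-continuous paths. -/
lemma IsLevyProcess.exists_rightCont {P : Measure Ω} {X : ℝ → Ω → ℝ} (hX : IsLevyProcess P X) :
    ∃ Y : ℝ → Ω → ℝ, IsRightContLevy P Y ∧ ∀ᵐ ω ∂P, ∀ t, 0 ≤ t → Y t ω = X t ω := by
  classical
  obtain ⟨Ω₀, hae, hmeas, hΩ₀⟩ := hX.cadlag.exists_measurable_mem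
  have hYX : ∀ᵐ ω ∂P, ∀ t, 0 ≤ t →
      (if ω ∈ Ω₀ then X (max t 0) ω else 0) = X t ω := by
    filter_upwards [hae] with ω hω t ht
    rw [if_pos hω, max_eq_left ht]
  refine ⟨fun t ω => if ω ∈ Ω₀ then X (max t 0) ω else 0, ?_, hYX⟩
  refine ⟨fun t => ?_, fun ω t => ?_, fun s t hs hst => ?_, fun s t hs hst n u hu => ?_⟩
  · exact Measurable.ite hmeas (hX.measurable _) measurable_const
  · by_cases hω : ω ∈ Ω₀
    · simp only [if_pos hω]
      exact continuousWithinAt_Ici_comp_monotone (k := fun s => max s 0) (by fun_prop)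
        (fun a b hab => max_le_max_right 0 hab) (hΩ₀ ω hω _ (le_max_right _ _)).1
    · simp only [if_neg hω]
      exact continuousWithinAt_const
  · rw [Measure.map_congr (g := fun ω => X t ω - X s ω), hX.stationary s t hs hst]
    · refine Measure.map_congr ?_
      filter_upwards [hYX] with ω hω
      exact (hω _ (by linarith)).symm
    · filter_upwards [hYX] with ω hω
      rw [hω t (hs.trans hst), hω s hs]
  · refine (hX.indep s t hs hst n u hu).congr ?_ ?_
    · filter_upwards [hYX] with ω hω
      rw [hω t (hs.trans hst), hω s hs]
    · filter_upwards [hYX] with ω hω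
      funext i
      exact (hω _ (hu i).1).symm

namespace IsRightContLevy

variable {P : Measure Ω} {X : ℝ → Ω → ℝ}

lemma measurable_uncurry (hX : IsRightContLevy P X) : Measurable (Function.uncurry X) :=
  measurable_uncurry_of_rightContinuous hX.measurable hX.rightCont

lemma measurable_path (hX : IsRightContLevy P X) (ω : Ω) : Measurable fun t => X t ω :=
  hX.measurable_uncurry.comp measurable_prodMk_right

lemma indepFun_past [IsProbabilityMeasure P] (hX : IsRightContLevy P X) {s t : ℝ} (hs : 0 ≤ s)
    (hst : s ≤ t) :
    IndepFun (fun ω (u : Icc (0 : ℝ) s) => X u ω) (fun ω => X t ω - X s ω) P := by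
  refine IndepFun.process_indepFun (fun u => hX.measurable u)
    ((hX.measurable t).sub (hX.measurable s)) fun I => ?_
  set e := I.equivFin
  have h := (hX.indep s t hs hst I.card (fun i => ((e.symm i : I) : Icc (0 : ℝ) s)) (fun i =>
    (e.symm i : I).1.2)).symm
  have := h.comp (φ := fun (x : Fin I.card → ℝ) (i : I) => x (e i)) (ψ := id)
    (by fun_prop) measurable_id
  simpa [Function.comp_def] using this

end IsRightContLevy

lemma sojourn_eq_of_eqOn {Ω : Type*} {X Y : ℝ → Ω → ℝ} {t : ℝ} (ht : 0 ≤ t) {ω : Ω}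
    (h : ∀ s ∈ Icc 0 t, X s ω = Y s ω) : sojourn X t ω = sojourn Y t ω := by
  refine intervalIntegral.integral_congr fun s hs => ?_
  rw [uIcc_of_le ht] at hs
  simp only [h s hs]

lemma measurable_sojourn_of_measurable_uncurry {Ω : Type*} {m : MeasurableSpace Ω}
    {Z : ℝ → Ω → ℝ} (hZ : Measurable (Function.uncurry Z)) (t : ℝ) : Measurable (sojourn Z t) := by
  have h : Measurable fun y : Ω × ℝ => if 0 < Z y.2 y.1 then (1 : ℝ) else 0 :=
    Measurable.ite (measurableSet_lt measurable_const (hZ.comp measurable_swap))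
      measurable_const measurable_const
  unfold sojourn intervalIntegral
  exact (h.stronglyMeasurable.integral_prod_right'.measurable).sub
    (h.stronglyMeasurable.integral_prod_right'.measurable)

namespace IsRightContLevy

variable {P : Measure Ω} {X : ℝ → Ω → ℝ}

lemma indepFun_sojourn [IsProbabilityMeasure P] (hX : IsRightContLevy P X) {s t : ℝ} (hs : 0 ≤ s)
    (hst : s ≤ t) :
    IndepFun (fun ω => (sojourn X s ω, X s ω)) (fun ω => X t ω - X s ω) P := by
  have hrc := hX.rightCont
  have hpast := (IndepFun_iff_Indep _ _ _).1 (hX.indepFun_past hs hst)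
  set m : MeasurableSpace Ω :=
    MeasurableSpace.comap (fun ω (u : Icc (0 : ℝ) s) => X u ω) inferInstance with hm
  have hproc : Measurable[m] (fun ω (u : Icc (0 : ℝ) s) => X u ω) := comap_measurable _
  have hmX : ∀ u, 0 ≤ u → u ≤ s → Measurable[m] (X u) := fun u h0 h1 =>
    (measurable_pi_apply (⟨u, h0, h1⟩ : Icc (0 : ℝ) s)).comp hproc
  have hZ : Measurable[MeasurableSpace.prod (borel ℝ) m]
      (Function.uncurry fun r => X (max 0 (min r s))) := by
    refine measurable_uncurry_of_rightContinuous (m := m)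
      (fun r => hmX _ (le_max_left _ _) (max_le hs (min_le_right _ _))) fun ω r => ?_
    exact continuousWithinAt_Ici_comp_monotone (k := fun r => max 0 (min r s)) (by fun_prop)
      (fun a b hab => max_le_max_left 0 (min_le_min_right s hab)) (hrc ω _)
  have hsoj : Measurable[m] (sojourn X s) := by
    have h := measurable_sojourn_of_measurable_uncurry (m := m) hZ s
    convert h using 1
    funext ω
    refine intervalIntegral.integral_congr fun r hr => ?_
    rw [uIcc_of_le hs] at hr
    simp only [min_eq_left hr.2, max_eq_right hr.1]
  have hpair : Measurable[m] fun ω => (sojourn X s ω, X s ω) := hsoj.prodMk (hmX s hs le_rfl)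
  rw [IndepFun_iff_Indep]
  exact indep_of_indep_of_le_left hpast hpair.comap_le

lemma intervalIntegrable_indicator (hX : IsRightContLevy P X) (ω : Ω) (a b : ℝ) :
    IntervalIntegrable (fun s => if 0 < X s ω then (1 : ℝ) else 0) volume a b := by
  have hm : Measurable fun s => if 0 < X s ω then (1 : ℝ) else 0 :=
    Measurable.ite (measurableSet_lt measurable_const (hX.measurable_path ω)) measurable_const
      measurable_const
  refine (intervalIntegrable_const (c := (1 : ℝ))).mono_fun hm.aestronglyMeasurable
    (.of_forall fun s => ?_)
  dsimp only
  split_ifs <;> simp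

lemma sojourn_sub_le (hX : IsRightContLevy P X) (ω : Ω) (s t : ℝ) :
    |sojourn X t ω - sojourn X s ω| ≤ |t - s| := by
  unfold sojourn
  rw [intervalIntegral.integral_interval_sub_left (hX.intervalIntegrable_indicator ω _ _)
    (hX.intervalIntegrable_indicator ω _ _)]
  have h := intervalIntegral.norm_integral_le_of_norm_le_const (a := s) (b := t) (C := 1)
    (f := fun r => if 0 < X r ω then (1 : ℝ) else 0) fun r _ => by split_ifs <;> simp
  simpa using h

lemma sojourn_nonneg {Ω : Type*} (X : ℝ → Ω → ℝ) {t : ℝ} (ht : 0 ≤ t) (ω : Ω) : 0 ≤ sojourn X t ω :=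
  intervalIntegral.integral_nonneg ht fun s _ => by positivity

lemma continuous_sojourn (hX : IsRightContLevy P X) (ω : Ω) :
    Continuous fun t => sojourn X t ω :=
  (LipschitzWith.of_dist_le_mul (K := 1) fun t s => by
    simpa [Real.dist_eq] using hX.sojourn_sub_le ω s t).continuous

lemma measurable_uncurry_sojourn (hX : IsRightContLevy P X) :
    Measurable (Function.uncurry (sojourn X)) :=
  measurable_uncurry_of_continuous_of_measurable (u := sojourn X) hX.continuous_sojourn
    (measurable_sojourn_of_measurable_uncurry hX.measurable_uncurry)

lemma abs_exp_neg_mul_sub_le {l a b : ℝ} (hl : 0 ≤ l) (ha : 0 ≤ a) (hb : 0 ≤ b) :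
    |Real.exp (-l * a) - Real.exp (-l * b)| ≤ l * |a - b| := by
  wlog hab : a ≤ b generalizing a b
  · rw [abs_sub_comm, abs_sub_comm a]
    exact this hb ha (le_of_not_ge hab)
  have h1 : Real.exp (-l * b) = Real.exp (-l * a) * Real.exp (-l * (b - a)) := by
    rw [← Real.exp_add]; ring_nf
  have h2 := Real.add_one_le_exp (-l * (b - a))
  have h3 : Real.exp (-l * (b - a)) ≤ 1 := Real.exp_le_one_iff.2 (by nlinarith)
  have h4 : Real.exp (-l * a) ≤ 1 := Real.exp_le_one_iff.2 (by nlinarith)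
  rw [abs_sub_comm a, abs_of_nonneg (by linarith : 0 ≤ b - a), abs_of_nonneg] <;>
  nlinarith [Real.exp_pos (-l * a)]

/-- The linear integral equation solved by `exp (-l A_t)`. -/
lemma exp_neg_sojourn_eq (hX : IsRightContLevy P X) {l t : ℝ} (hl : 0 ≤ l) (ht : 0 ≤ t) (ω : Ω) :
    Real.exp (-l * sojourn X t ω) = 1 - l * ∫ s in (0 : ℝ)..t,
      (if 0 < X s ω then (1 : ℝ) else 0) * Real.exp (-l * sojourn X s ω) := by
  have hac : AbsolutelyContinuousOnInterval (fun s => Real.exp (-l * sojourn X s ω)) 0 t := by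
    refine LipschitzOnWith.absolutelyContinuousOnInterval (K := l.toNNReal) ?_
    refine LipschitzOnWith.of_dist_le_mul fun a ha b hb => ?_
    rw [uIcc_of_le ht] at ha hb
    rw [Real.coe_toNNReal _ hl, Real.dist_eq, Real.dist_eq]
    refine (abs_exp_neg_mul_sub_le hl (sojourn_nonneg X ha.1 ω) (sojourn_nonneg X hb.1 ω)).trans ?_
    exact mul_le_mul_of_nonneg_left (hX.sojourn_sub_le ω b a) hl
  have h := hac.integral_deriv_eq_sub
  have h0 : sojourn X 0 ω = 0 := by simp [sojourn]
  have hd : ∫ s in (0 : ℝ)..t, deriv (fun s => Real.exp (-l * sojourn X s ω)) s =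
      ∫ s in (0 : ℝ)..t, -l *
        ((if 0 < X s ω then (1 : ℝ) else 0) * Real.exp (-l * sojourn X s ω)) := by
    refine intervalIntegral.integral_congr_ae ?_
    filter_upwards [(hX.intervalIntegrable_indicator ω 0 t).ae_hasDerivAt_integral] with s hs hs'
    have h1 := hs (uIoc_subset_uIcc hs') 0 left_mem_uIcc
    have h2 : HasDerivAt (fun s => Real.exp (-l * sojourn X s ω)) _ s := (h1.const_mul (-l)).exp
    rw [h2.deriv]
    simp only [sojourn]
    ring
  rw [hd, intervalIntegral.integral_const_mul, h0] at h
  simp only [mul_zero, Real.exp_zero] at h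
  linarith

end IsRightContLevy

lemma norm_cexp_mul_I_le (θ x : ℝ) : ‖Complex.exp (θ * x * Complex.I)‖ ≤ 1 := by
  rw [← Complex.ofReal_mul, Complex.norm_exp_ofReal_mul_I]

lemma measurable_cexp_mul_I (θ : ℝ) : Measurable fun x : ℝ => Complex.exp (θ * x * Complex.I) := by
  fun_prop

lemma norm_indicator_cexp_le (S : Set ℝ) (θ x : ℝ) :
    ‖S.indicator (fun x : ℝ => Complex.exp (θ * x * Complex.I)) x‖ ≤ 1 :=
  (norm_indicator_le_norm_self _ _).trans (norm_cexp_mul_I_le θ x)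

lemma integrable_weight_mul {P : Measure Ω} [IsProbabilityMeasure P] {X W : ℝ → Ω → ℝ} {k : ℝ → ℝ}
    (hX : Measurable (Function.uncurry X)) (hW : Measurable (Function.uncurry W))
    (hW0 : ∀ t ω, 0 < t → 0 ≤ W t ω) (hWk : ∀ t ω, 0 < t → W t ω ≤ k t)
    (hk : IntegrableOn k (Ioi 0)) {g : ℝ → ℂ} (hg : Measurable g) (hg1 : ∀ x, ‖g x‖ ≤ 1) :
    Integrable (fun y : ℝ × Ω => (W y.1 y.2 : ℂ) * g (X y.1 y.2))
      ((volume.restrict (Ioi 0)).prod P) := by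
  have hk' : Integrable (fun y : ℝ × Ω => k y.1) ((volume.restrict (Ioi 0)).prod P) :=
    Integrable.comp_fst hk P
  refine hk'.mono' ?_ ?_
  · have h1 : Measurable fun y : ℝ × Ω => W y.1 y.2 := hW
    have h2 : Measurable fun y : ℝ × Ω => X y.1 y.2 := hX
    exact ((Complex.measurable_ofReal.comp h1).mul (hg.comp h2)).aestronglyMeasurable
  · have h : ∀ᵐ y : ℝ × Ω ∂((volume.restrict (Ioi 0)).prod P), y.1 ∈ Ioi (0 : ℝ) :=
      Measure.quasiMeasurePreserving_fst.ae (ae_restrict_mem measurableSet_Ioi)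
    filter_upwards [h] with y hy
    rw [norm_mul, Complex.norm_real, Real.norm_of_nonneg (hW0 _ _ hy)]
    calc _ ≤ W y.1 y.2 * 1 := mul_le_mul_of_nonneg_left (hg1 _) (hW0 _ _ hy)
      _ ≤ _ := by rw [mul_one]; exact hWk _ _ hy

/-- The characteristic function of a weighted occupation measure of a process, restricted to a
set of states. -/
lemma exists_occupation_measure {P : Measure Ω} [IsProbabilityMeasure P] {X W : ℝ → Ω → ℝ}
    {k : ℝ → ℝ} (hX : Measurable (Function.uncurry X)) (hW : Measurable (Function.uncurry W))
    (hW0 : ∀ t ω, 0 < t → 0 ≤ W t ω) (hWk : ∀ t ω, 0 < t → W t ω ≤ k t)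
    (hk : IntegrableOn k (Ioi 0)) {S : Set ℝ} (hS : MeasurableSet S) :
    ∃ M : Measure ℝ, IsFiniteMeasure M ∧ M Sᶜ = 0 ∧ ∀ θ : ℝ, charFun M θ =
      ∫ t in Ioi (0 : ℝ), ∫ ω, (W t ω : ℂ) *
        S.indicator (fun x : ℝ => Complex.exp (θ * x * Complex.I)) (X t ω) ∂P := by
  set μ := (volume.restrict (Ioi (0 : ℝ))).prod P with hμ
  have hae : ∀ᵐ y : ℝ × Ω ∂μ, y.1 ∈ Ioi (0 : ℝ) :=
    Measure.quasiMeasurePreserving_fst.ae (ae_restrict_mem measurableSet_Ioi)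
  have hWS : Measurable fun y : ℝ × Ω => W y.1 y.2 * S.indicator (fun _ => (1 : ℝ)) (X y.1 y.2) :=
    Measurable.mul hW ((measurable_const.indicator hS).comp hX)
  set d : ℝ × Ω → ENNReal := fun y =>
    ENNReal.ofReal (W y.1 y.2 * S.indicator (fun _ => (1 : ℝ)) (X y.1 y.2)) with hd
  have hdm : Measurable d := hWS.ennreal_ofReal
  have hfin : ∫⁻ y, d y ∂μ ≠ ⊤ := by
    have hk' : Integrable (fun y : ℝ × Ω => k y.1) μ := Integrable.comp_fst hk P
    refine ne_top_of_le_ne_top hk'.lintegral_lt_top.ne (lintegral_mono_ae ?_)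
    filter_upwards [hae] with y hy
    refine ENNReal.ofReal_le_ofReal (le_trans ?_ (hWk y.1 y.2 hy))
    refine mul_le_of_le_one_right (hW0 _ _ hy) ?_
    by_cases h : X y.1 y.2 ∈ S <;> simp [h]
  have : IsFiniteMeasure (μ.withDensity d) := isFiniteMeasure_withDensity hfin
  refine ⟨(μ.withDensity d).map (Function.uncurry X), inferInstance, ?_, fun θ => ?_⟩
  · rw [Measure.map_apply hX hS.compl, withDensity_apply _ (hX hS.compl),
      setLIntegral_congr_fun (hX hS.compl) (g := fun _ => 0), lintegral_zero]
    intro y hy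
    have hy : X y.1 y.2 ∉ S := hy
    simp [hd, hy]
  · rw [charFun_apply_real, integral_map hX.aemeasurable
      (measurable_cexp_mul_I θ).aestronglyMeasurable,
      integral_withDensity_eq_integral_toReal_smul hdm (.of_forall fun y => ENNReal.ofReal_lt_top)]
    have h_integrable := integrable_weight_mul hX hW hW0 hWk hk (P := P)
      ((measurable_cexp_mul_I θ).indicator hS) (norm_indicator_cexp_le S θ)
    rw [← integral_prod _ h_integrable]
    refine integral_congr_ae ?_
    filter_upwards [hae] with y hy
    have h0 : 0 ≤ W y.1 y.2 := hW0 _ _ hy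
    by_cases h : X y.1 y.2 ∈ S
    · simp [hd, h, h0, Function.uncurry]
    · simp [hd, h]

lemma integral_weight_mul_indicator_add_compl {P : Measure Ω} [IsProbabilityMeasure P]
    {X W : ℝ → Ω → ℝ} {k : ℝ → ℝ} (hX : Measurable (Function.uncurry X))
    (hW : Measurable (Function.uncurry W))
    (hW0 : ∀ t ω, 0 < t → 0 ≤ W t ω) (hWk : ∀ t ω, 0 < t → W t ω ≤ k t)
    (hk : IntegrableOn k (Ioi 0)) {S : Set ℝ} (hS : MeasurableSet S) (θ : ℝ) :
    (∫ t in Ioi (0 : ℝ), ∫ ω, (W t ω : ℂ) *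
        S.indicator (fun x : ℝ => Complex.exp (θ * x * Complex.I)) (X t ω) ∂P) +
      ∫ t in Ioi (0 : ℝ), ∫ ω, (W t ω : ℂ) *
        Sᶜ.indicator (fun x : ℝ => Complex.exp (θ * x * Complex.I)) (X t ω) ∂P =
    ∫ t in Ioi (0 : ℝ), ∫ ω, (W t ω : ℂ) * Complex.exp (θ * X t ω * Complex.I) ∂P := by
  have h1 := integrable_weight_mul hX hW hW0 hWk hk (P := P)
      ((measurable_cexp_mul_I θ).indicator hS) (norm_indicator_cexp_le S θ)
  have h2 := integrable_weight_mul hX hW hW0 hWk hk (P := P)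
      ((measurable_cexp_mul_I θ).indicator hS.compl) (norm_indicator_cexp_le Sᶜ θ)
  have h3 := integrable_weight_mul hX hW hW0 hWk hk (P := P)
      (measurable_cexp_mul_I θ) (norm_cexp_mul_I_le θ)
  rw [← integral_prod _ h1, ← integral_prod _ h2, ← integral_prod _ h3, ← integral_add h1 h2]
  refine integral_congr_ae (.of_forall fun y => ?_)
  by_cases h : X y.1 y.2 ∈ S <;> simp [h]

lemma exp_neg_mul_sojourn_le_one {Ω : Type*} (X : ℝ → Ω → ℝ) {l t : ℝ} (hl : 0 ≤ l)
    (ht : 0 ≤ t) (ω : Ω) : Real.exp (-l * sojourn X t ω) ≤ 1 :=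
  Real.exp_le_one_iff.2 (by nlinarith [IsRightContLevy.sojourn_nonneg X ht ω])

namespace IsRightContLevy

variable {P : Measure Ω} {X : ℝ → Ω → ℝ}

lemma charFun_map (hX : IsRightContLevy P X) (t θ : ℝ) :
    charFun (P.map (X t)) θ = ∫ ω, Complex.exp (θ * X t ω * Complex.I) ∂P := by
  rw [charFun_apply_real, integral_map (hX.measurable t).aemeasurable
      (measurable_cexp_mul_I θ).aestronglyMeasurable]

lemma charFun_map_sub (hX : IsRightContLevy P X) {s t : ℝ} (hs : 0 ≤ s) (hst : s ≤ t) (θ : ℝ) :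
    ∫ ω, Complex.exp (θ * (X t ω - X s ω : ℝ) * Complex.I) ∂P =
      charFun (P.map (X (t - s))) θ := by
  have hm : Measurable fun ω => X t ω - X s ω := (hX.measurable t).sub (hX.measurable s)
  rw [← hX.stationary s t hs hst, charFun_apply_real, integral_map hm.aemeasurable
    (measurable_cexp_mul_I θ).aestronglyMeasurable]

lemma measurable_charFun_map [IsProbabilityMeasure P] (hX : IsRightContLevy P X) (θ : ℝ) :
    Measurable fun t => charFun (P.map (X t)) θ := by
  simp only [hX.charFun_map]
  exact ((measurable_cexp_mul_I θ).comp
    hX.measurable_uncurry).stronglyMeasurable.integral_prod_right'.measurable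

lemma norm_charFun_map_le [IsProbabilityMeasure P] (hX : IsRightContLevy P X) (t θ : ℝ) :
    ‖charFun (P.map (X t)) θ‖ ≤ 1 := by
  have := Measure.isProbabilityMeasure_map (hX.measurable t).aemeasurable (μ := P)
  exact norm_charFun_le_one θ

lemma integral_mul_exp_increment [IsProbabilityMeasure P] (hX : IsRightContLevy P X) {s t : ℝ}
    (hs : 0 ≤ s) (hst : s ≤ t) (θ : ℝ) {F : ℝ × ℝ → ℂ} (hF : Measurable F) :
    ∫ ω, F (sojourn X s ω, X s ω) * Complex.exp (θ * X t ω * Complex.I) ∂P =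
      (∫ ω, F (sojourn X s ω, X s ω) * Complex.exp (θ * X s ω * Complex.I) ∂P) *
        charFun (P.map (X (t - s))) θ := by
  have hG : Measurable fun x : ℝ × ℝ => F x * Complex.exp (θ * x.2 * Complex.I) := by fun_prop
  have hind := (hX.indepFun_sojourn hs hst).comp hG (measurable_cexp_mul_I θ)
  have hm1 := hG.comp ((measurable_sojourn_of_measurable_uncurry hX.measurable_uncurry s).prodMk
    (hX.measurable s))
  have hm2 := (measurable_cexp_mul_I θ).comp ((hX.measurable t).sub (hX.measurable s))
  rw [← hX.charFun_map_sub hs hst]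
  have h := hind.integral_fun_mul_eq_mul_integral hm1.aestronglyMeasurable
    hm2.aestronglyMeasurable
  simp only [Function.comp_def] at h
  rw [← h]
  refine integral_congr_ae (.of_forall fun ω => ?_)
  dsimp only
  rw [mul_assoc (F _), ← Complex.exp_add]
  congr 2
  push_cast
  ring

lemma charFun_map_add [IsProbabilityMeasure P] (hX : IsRightContLevy P X) (θ s t : ℝ)
    (hs : 0 ≤ s) (ht : 0 ≤ t) :
    charFun (P.map (X (s + t))) θ = charFun (P.map (X s)) θ * charFun (P.map (X t)) θ := by
  have h := hX.integral_mul_exp_increment hs (by linarith : s ≤ s + t) θ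
    (F := fun _ => 1) measurable_const
  simpa [hX.charFun_map s, hX.charFun_map (s + t)] using h

lemma measurable_discounted_sojourn (hX : IsRightContLevy P X) (q l : ℝ) :
    Measurable (Function.uncurry fun t ω => Real.exp (-q * t) * Real.exp (-l * sojourn X t ω)) := by
  have h : Measurable fun y : ℝ × Ω => sojourn X y.1 y.2 := hX.measurable_uncurry_sojourn
  have : Measurable fun y : ℝ × Ω => Real.exp (-q * y.1) * Real.exp (-l * sojourn X y.1 y.2) := by
    fun_prop
  exact this

/-- Decomposition of the discounted characteristic function at the times the process is
positive. -/
lemma integral_exp_neg_sojourn_mul_cexp [IsProbabilityMeasure P] (hX : IsRightContLevy P X)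
    {l t : ℝ} (hl : 0 ≤ l) (ht : 0 ≤ t) (θ : ℝ) :
    ∫ ω, (Real.exp (-l * sojourn X t ω) : ℂ) * Complex.exp (θ * X t ω * Complex.I) ∂P =
      charFun (P.map (X t)) θ - l * ∫ s in (0 : ℝ)..t,
        (∫ ω, (Real.exp (-l * sojourn X s ω) : ℂ) *
          (Ioi (0 : ℝ)).indicator (fun x : ℝ => Complex.exp (θ * x * Complex.I)) (X s ω) ∂P) *
        charFun (P.map (X (t - s))) θ := by
  have hA : Measurable fun y : ℝ × Ω => sojourn X y.1 y.2 := hX.measurable_uncurry_sojourn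
  have hXm : Measurable fun y : ℝ × Ω => X y.1 y.2 := hX.measurable_uncurry
  have hXt : Measurable (X t) := hX.measurable t
  set K : ℝ → Ω → ℝ := fun s ω =>
    (if 0 < X s ω then (1 : ℝ) else 0) * Real.exp (-l * sojourn X s ω) with hK
  have hKm : Measurable (Function.uncurry K) :=
    Measurable.mul (Measurable.ite (measurableSet_lt measurable_const hXm) measurable_const
      measurable_const) (by fun_prop)
  have hfm : Measurable (Function.uncurry fun s ω =>
      (K s ω : ℂ) * Complex.exp (θ * X t ω * Complex.I)) := by
    have h : Measurable fun y : ℝ × Ω => K y.1 y.2 := hKm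
    have : Measurable fun y : ℝ × Ω =>
      (K y.1 y.2 : ℂ) * Complex.exp (θ * X t y.2 * Complex.I) := by fun_prop
    exact this
  have h_integrable : Integrable (Function.uncurry fun s ω =>
      (K s ω : ℂ) * Complex.exp (θ * X t ω * Complex.I))
      ((volume.restrict (uIoc 0 t)).prod P) := by
    have hae : ∀ᵐ y : ℝ × Ω ∂((volume.restrict (uIoc 0 t)).prod P), y.1 ∈ uIoc 0 t :=
      Measure.quasiMeasurePreserving_fst.ae (ae_restrict_mem measurableSet_uIoc)
    have : IsFiniteMeasure (volume.restrict (uIoc 0 t)) :=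
      ⟨by simp [uIoc_of_le ht]⟩
    refine (integrable_const (1 : ℝ)).mono' hfm.aestronglyMeasurable ?_
    filter_upwards [hae] with y hy
    rw [uIoc_of_le ht] at hy
    simp only [Function.uncurry, hK]
    rw [norm_mul, Complex.norm_real, norm_mul, Real.norm_of_nonneg (Real.exp_pos _).le]
    refine mul_le_one₀ (mul_le_one₀ ?_ (Real.exp_pos _).le
      (exp_neg_mul_sojourn_le_one X hl hy.1.le _)) (norm_nonneg _) (norm_cexp_mul_I_le _ _)
    split_ifs <;> simp
  have hpt : ∀ ω, (Real.exp (-l * sojourn X t ω) : ℂ) * Complex.exp (θ * X t ω * Complex.I) =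
      Complex.exp (θ * X t ω * Complex.I) - l * ∫ s in (0 : ℝ)..t,
        (K s ω : ℂ) * Complex.exp (θ * X t ω * Complex.I) := fun ω => by
    rw [hX.exp_neg_sojourn_eq hl ht ω, intervalIntegral.integral_mul_const,
      intervalIntegral.integral_ofReal]
    push_cast
    ring
  have hint1 : Integrable (fun ω => Complex.exp (θ * X t ω * Complex.I)) P :=
    (integrable_const (1 : ℝ)).mono' ((measurable_cexp_mul_I θ).comp hXt).aestronglyMeasurable
      (.of_forall fun ω => norm_cexp_mul_I_le _ _)
  have hint2 : Integrable (fun ω => ∫ s in (0 : ℝ)..t,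
        (K s ω : ℂ) * Complex.exp (θ * X t ω * Complex.I)) P := by
    have := h_integrable.integral_prod_right
    simpa [intervalIntegral.integral_of_le ht, uIoc_of_le ht, Function.uncurry] using this
  simp_rw [hpt]
  rw [integral_sub hint1 (hint2.const_mul _), integral_const_mul, ← hX.charFun_map,
    ← intervalIntegral_integral_swap h_integrable]
  congr 2
  refine intervalIntegral.integral_congr fun s hs => ?_
  rw [uIcc_of_le ht] at hs
  have hF : Measurable fun x : ℝ × ℝ =>
      (((if 0 < x.2 then (1 : ℝ) else 0) * Real.exp (-l * x.1) : ℝ) : ℂ) :=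
    Complex.measurable_ofReal.comp (Measurable.mul (Measurable.ite
      (measurableSet_lt measurable_const measurable_snd) measurable_const measurable_const)
      (by fun_prop))
  have h := hX.integral_mul_exp_increment hs.1 hs.2 θ hF
  dsimp only at h ⊢
  rw [h]
  congr 1
  refine integral_congr_ae (.of_forall fun ω => ?_)
  by_cases h0 : 0 < X s ω <;> simp [h0]

/-- The Laplace transform of the renewal equation. -/
lemma laplace_exp_neg_sojourn [IsProbabilityMeasure P] (hX : IsRightContLevy P X)
    {q l : ℝ} (hq : 0 < q) (hl : 0 ≤ l) (θ : ℝ) :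
    ∫ t in Ioi (0 : ℝ), ∫ ω, ((Real.exp (-q * t) * Real.exp (-l * sojourn X t ω) : ℝ) : ℂ) *
      Complex.exp (θ * X t ω * Complex.I) ∂P =
    (∫ t in Ioi (0 : ℝ), (Real.exp (-q * t) : ℂ) * charFun (P.map (X t)) θ) -
      l * ((∫ t in Ioi (0 : ℝ), ∫ ω,
        ((Real.exp (-q * t) * Real.exp (-l * sojourn X t ω) : ℝ) : ℂ) *
          (Ioi (0 : ℝ)).indicator (fun x : ℝ => Complex.exp (θ * x * Complex.I)) (X t ω) ∂P) *
        ∫ t in Ioi (0 : ℝ), (Real.exp (-q * t) : ℂ) * charFun (P.map (X t)) θ) := by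
  have i1 := integrableOn_ofReal_mul (integrableOn_exp_neg_mul hq) (hX.measurable_charFun_map θ)
    (fun t => hX.norm_charFun_map_le t θ)
  have hWk : ∀ t ω, 0 < t →
      Real.exp (-q * t) * Real.exp (-l * sojourn X t ω) ≤ Real.exp (-q * t) := fun t ω ht =>
    mul_le_of_le_one_right (Real.exp_pos _).le (exp_neg_mul_sojourn_le_one X hl ht.le ω)
  have hW0 : ∀ t ω, 0 < t → 0 ≤ Real.exp (-q * t) * Real.exp (-l * sojourn X t ω) :=
    fun t ω _ => by positivity
  have i2 := (integrable_weight_mul hX.measurable_uncurry (hX.measurable_discounted_sojourn q l)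
    hW0 hWk (integrableOn_exp_neg_mul hq) (P := P) ((measurable_cexp_mul_I θ).indicator
      measurableSet_Ioi) (norm_indicator_cexp_le (Ioi 0) θ)).integral_prod_left
  have i3 := (integrable_weight_mul hX.measurable_uncurry (hX.measurable_discounted_sojourn q l)
    hW0 hWk (integrableOn_exp_neg_mul hq) (P := P) (measurable_cexp_mul_I θ)
      (norm_cexp_mul_I_le θ)).integral_prod_left
  have hconv := integral_posConvolution i2 i1 (ContinuousLinearMap.mul ℝ ℂ)
  simp only [ContinuousLinearMap.mul_apply'] at hconv
  have key : ∀ t ∈ Ioi (0 : ℝ), l * ∫ s in (0 : ℝ)..t, (∫ ω,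
        ((Real.exp (-q * s) * Real.exp (-l * sojourn X s ω) : ℝ) : ℂ) *
          (Ioi (0 : ℝ)).indicator (fun x : ℝ => Complex.exp (θ * x * Complex.I)) (X s ω) ∂P) *
        ((Real.exp (-q * (t - s)) : ℂ) * charFun (P.map (X (t - s))) θ) =
      (Real.exp (-q * t) : ℂ) * charFun (P.map (X t)) θ -
      ∫ ω, ((Real.exp (-q * t) * Real.exp (-l * sojourn X t ω) : ℝ) : ℂ) *
        Complex.exp (θ * X t ω * Complex.I) ∂P := by
    intro t ht
    have ht : 0 < t := ht
    simp only [Complex.ofReal_mul, mul_assoc (Complex.ofReal (Real.exp (-q * _))),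
      integral_const_mul]
    simp only [← mul_assoc (Complex.ofReal (Real.exp (-q * _)))]
    rw [hX.integral_exp_neg_sojourn_mul_cexp hl ht.le θ, mul_sub, sub_sub_cancel, ← mul_assoc,
      mul_comm _ (l : ℂ), mul_assoc]
    congr 1
    rw [← intervalIntegral.integral_const_mul]
    refine intervalIntegral.integral_congr fun s _ => ?_
    have e : Real.exp (-q * t) = Real.exp (-q * s) * Real.exp (-q * (t - s)) := by
      rw [← Real.exp_add]; ring_nf
    rw [e]
    push_cast
    ring
  rw [← hconv, ← integral_const_mul, setIntegral_congr_fun measurableSet_Ioi key,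
    integral_sub i1 i3, sub_sub_cancel]

end IsRightContLevy

namespace IsRightContLevy

variable {P : Measure Ω} {X : ℝ → Ω → ℝ} [IsProbabilityMeasure P]

/-- The Wiener–Hopf factor of the positive half-line. -/
lemma one_sub_mul_laplace_eq_exp (hX : IsRightContLevy P X) {q l : ℝ} (hq : 0 < q) (hl : 0 ≤ l)
    (θ : ℝ) :
    1 - l * (∫ t in Ioi (0 : ℝ), ∫ ω,
      ((Real.exp (-q * t) * Real.exp (-l * sojourn X t ω) : ℝ) : ℂ) *
        (Ioi (0 : ℝ)).indicator (fun x : ℝ => Complex.exp (θ * x * Complex.I)) (X t ω) ∂P) =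
    Complex.exp (-∫ t in Ioi (0 : ℝ), ∫ ω, (frullaniWeight q l t : ℂ) *
        (Ioi (0 : ℝ)).indicator (fun x : ℝ => Complex.exp (θ * x * Complex.I)) (X t ω) ∂P) := by
  have hWk : ∀ t ω, 0 < t →
      Real.exp (-q * t) * Real.exp (-l * sojourn X t ω) ≤ Real.exp (-q * t) := fun t ω ht =>
    mul_le_of_le_one_right (Real.exp_pos _).le (exp_neg_mul_sojourn_le_one X hl ht.le ω)
  have hW0 : ∀ t ω, 0 < t → 0 ≤ Real.exp (-q * t) * Real.exp (-l * sojourn X t ω) :=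
    fun t ω _ => by positivity
  have hWm := hX.measurable_discounted_sojourn q l
  have hVk : ∀ t (_ : Ω), 0 < t → frullaniWeight q l t ≤ frullaniWeight q l t :=
    fun _ _ _ => le_rfl
  have hV0 : ∀ t (_ : Ω), 0 < t → 0 ≤ frullaniWeight q l t :=
    fun _ _ ht => frullaniWeight_nonneg hl ht
  have hVm : Measurable (Function.uncurry fun t (_ : Ω) => frullaniWeight q l t) :=
    (measurable_frullaniWeight q l).comp measurable_fst
  have hS : MeasurableSet (Ioi (0 : ℝ)) := measurableSet_Ioi
  have hSadd : ∀ x ∈ Ioi (0 : ℝ), ∀ y ∈ Ioi (0 : ℝ), x + y ∈ Ioi (0 : ℝ) :=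
    fun x hx y hy => mem_Ioi.2 (add_pos hx hy)
  have hSadd' : ∀ x ∈ (Ioi (0 : ℝ))ᶜ, ∀ y ∈ (Ioi (0 : ℝ))ᶜ, x + y ∈ (Ioi (0 : ℝ))ᶜ := by
    simp only [compl_Ioi, mem_Iic]
    intros
    linarith
  have kW := integrableOn_exp_neg_mul hq
  have kV := integrableOn_frullaniWeight hq hl
  have hXm := hX.measurable_uncurry
  obtain ⟨Up, _, hUp0, hUp⟩ := exists_occupation_measure (P := P) hXm hWm hW0 hWk kW hS
  obtain ⟨Un, _, hUn0, hUn⟩ := exists_occupation_measure (P := P) hXm hWm hW0 hWk kW hS.compl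
  obtain ⟨Vp, _, hVp0, hVp⟩ := exists_occupation_measure (P := P) hXm hVm hV0 hVk kV hS
  obtain ⟨Vn, _, hVn0, hVn⟩ := exists_occupation_measure (P := P) hXm hVm hV0 hVk kV hS.compl
  rw [← hUp, ← hVp]
  have hfac : ∀ θ : ℝ, 1 + l * charFun Un θ =
      (1 - l * charFun Up θ) * Complex.exp (charFun Vp θ + charFun Vn θ) := by
    intro θ
    have hU := integral_weight_mul_indicator_add_compl (P := P) hXm hWm hW0 hWk kW hS θ
    have hV := integral_weight_mul_indicator_add_compl (P := P) hXm hVm hV0 hVk kV hS θ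
    have hL := hX.laplace_exp_neg_sojourn hq hl θ
    have hG := one_add_mul_laplace_eq_exp (hX.measurable_charFun_map θ)
      (fun t => hX.norm_charFun_map_le t θ) (hX.charFun_map_add θ) hq hl
    rw [← hUp, ← hUn] at hU
    rw [← hVp, ← hVn] at hV
    rw [← hU, ← hUp] at hL
    simp only [integral_const_mul, ← hX.charFun_map] at hV
    rw [hV, ← hG]
    linear_combination (l : ℂ) * hL
  set f : ℝ → ℂ := fun θ => (1 - l * charFun Up θ) * Complex.exp (charFun Vp θ) - 1 with hf
  have h1 : IsSignedCharFun (Ioi 0) f := by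
    have hE := IsSignedCharFun.exp_sub_one hS hSadd Vp hVp0 1
    have hU := (IsSignedCharFun.of_charFun (l.toNNReal • Up) (S := Ioi 0)
      (by simp only [Measure.smul_apply, hUp0, smul_zero])).neg
    convert (hE.add hU).add (hU.mul hS hSadd hE) using 1
    funext θ
    rw [charFun_smul_measure]
    simp only [hf, Complex.ofReal_one, one_mul]
    rw [Real.coe_toNNReal _ hl]
    ring
  have h2 : IsSignedCharFun (Ioi 0)ᶜ f := by
    have hE := IsSignedCharFun.exp_sub_one hS.compl hSadd' Vn hVn0 (-1)
    have hU := IsSignedCharFun.of_charFun (l.toNNReal • Un) (S := (Ioi 0)ᶜ)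
      (by simp only [Measure.smul_apply, hUn0, smul_zero])
    convert (hE.add hU).add (hU.mul hS.compl hSadd' hE) using 1
    funext θ
    rw [charFun_smul_measure]
    have e : (1 - l * charFun Up θ) * Complex.exp (charFun Vp θ) =
        (1 + l * charFun Un θ) * Complex.exp (-charFun Vn θ) := by
      rw [hfac, mul_assoc, ← Complex.exp_add, add_neg_cancel_right]
    simp only [hf, e, Complex.ofReal_neg, Complex.ofReal_one, neg_mul, one_mul]
    rw [Real.coe_toNNReal _ hl]
    ring
  have h0 := h1.eq_zero h2 θ
  rw [Complex.exp_neg]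
  exact eq_inv_of_mul_eq_one_left (sub_eq_zero.1 h0)

/-- The double Laplace transform of the positive sojourn time in terms of the positivity
function. -/
theorem double_laplace_sojourn (hX : IsRightContLevy P X) {q l : ℝ} (hq : 0 < q) (hl : 0 ≤ l) :
    ∫ t in Ioi (0 : ℝ), Real.exp (-q * t) * ∫ ω, Real.exp (-l * sojourn X t ω) ∂P =
      1 / q * Real.exp (-∫ t in Ioi (0 : ℝ), frullaniWeight q l t * P.real {ω | 0 < X t ω}) := by
  have h1 := hX.one_sub_mul_laplace_eq_exp hq hl 0
  have h2 := hX.laplace_exp_neg_sojourn hq hl 0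
  have hind : ∀ x : ℝ, (Ioi (0 : ℝ)).indicator
      (fun x : ℝ => Complex.exp ((0 : ℝ) * x * Complex.I)) x =
      (((Ioi (0 : ℝ)).indicator (fun _ => (1 : ℝ)) x : ℝ) : ℂ) := fun x => by
    by_cases h : 0 < x <;> simp [h]
  have hchar : ∀ t, charFun (P.map (X t)) 0 = 1 := fun t => by
    simp [hX.charFun_map]
  have hp : ∀ t, ∫ ω, (Ioi (0 : ℝ)).indicator (fun _ => (1 : ℝ)) (X t ω) ∂P =
      P.real {ω | 0 < X t ω} := fun t => by
    exact integral_indicator_one (μ := P) (hX.measurable t measurableSet_Ioi)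
  simp only [hind] at h1 h2
  simp only [hchar, Complex.ofReal_zero, zero_mul, Complex.exp_zero, mul_one] at h2
  simp only [← Complex.ofReal_mul, integral_complex_ofReal] at h1 h2
  rw [integral_exp_neg_mul_Ioi hq] at h2
  norm_cast at h1 h2
  simp only [integral_const_mul] at h1 h2
  simp only [hp] at h1
  rw [h2, ← h1]
  ring

end IsRightContLevy

lemma exists_mem_Ioo_of_ae {R : ℝ → Prop} (h : ∀ᵐ t, R t) {a b : ℝ} (hab : a < b) :
    ∃ t ∈ Ioo a b, R t := by
  by_contra! hcon
  have h0 : volume (Ioo a b) = 0 := measure_mono_null (fun t ht => hcon t ht) (ae_iff.1 h)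
  rw [Real.volume_Ioo, ENNReal.ofReal_eq_zero] at h0
  linarith

lemma tendsto_volume_diff_preimage_add {Z : Set ℝ} (hZ : MeasurableSet Z) (hfin : volume Z ≠ ⊤) :
    Tendsto (fun r : ℝ => volume (Z \ (fun s => s + r) ⁻¹' Z)) (nhdsWithin 0 (Ioi 0)) (nhds 0) := by
  have h := tendsto_measure_symmDiff_preimage_nhds_zero (μ := volume) (ν := volume)
    (l := nhdsWithin (0 : ℝ) (Ioi 0)) (f := fun r : ℝ => ContinuousMap.mk (fun s : ℝ => s + r))
    (g := ContinuousMap.id ℝ) (s := Z) ?_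
    (.of_forall fun r => measurePreserving_add_right volume r) (MeasurePreserving.id volume)
    hZ.nullMeasurableSet hfin
  · refine tendsto_of_tendsto_of_tendsto_of_le_of_le tendsto_const_nhds h (fun _ => zero_le)
      fun r => measure_mono fun s hs => ?_
    exact Or.inr hs
  · have hc : Continuous fun r : ℝ => ContinuousMap.mk (fun s : ℝ => s + r) :=
      ContinuousMap.continuous_of_continuous_uncurry _
        (by fun_prop : Continuous fun x : ℝ × ℝ => x.2 + x.1)
    have h0 := hc.tendsto 0
    have e : ContinuousMap.mk (fun s : ℝ => s + 0) = ContinuousMap.id ℝ := by ext; simp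
    rw [e] at h0
    exact h0.mono_left nhdsWithin_le_nhds

namespace IsRightContLevy

variable {P : Measure Ω} {X : ℝ → Ω → ℝ}

lemma measurable_increment (hX : IsRightContLevy P X) (s t : ℝ) :
    Measurable fun ω => X t ω - X s ω :=
  (hX.measurable t).sub (hX.measurable s)

lemma measure_increment (hX : IsRightContLevy P X) {s t : ℝ} (hs : 0 ≤ s) (hst : s ≤ t)
    {B : Set ℝ} (hB : MeasurableSet B) :
    P {ω | X t ω - X s ω ∈ B} = P {ω | X (t - s) ω ∈ B} := by
  have h := congrArg (fun m : Measure ℝ => m B) (hX.stationary s t hs hst)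
  simp only [Measure.map_apply (hX.measurable_increment s t) hB,
    Measure.map_apply (hX.measurable (t - s)) hB] at h
  exact h

lemma indepFun_increment [IsProbabilityMeasure P] (hX : IsRightContLevy P X) {s t : ℝ}
    (hs : 0 ≤ s) (hst : s ≤ t) :
    IndepFun (X s) (fun ω => X t ω - X s ω) P :=
  (hX.indepFun_sojourn hs hst).comp measurable_snd measurable_id

lemma measure_preimage_le_of_isOpen (hX : IsRightContLevy P X) {U : Set ℝ} (hU : IsOpen U)
    {C : ENNReal} (h : ∀ᵐ s, 0 < s → P {ω | X s ω ∈ U} ≤ C) {t : ℝ} (ht : 0 ≤ t) :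
    P {ω | X t ω ∈ U} ≤ C := by
  choose s hs hsC using fun n : ℕ => exists_mem_Ioo_of_ae h
    (show t < t + 1 / ((n : ℝ) + 1) by simp; positivity)
  have hlim : Tendsto s atTop (nhdsWithin t (Ici t)) := by
    refine tendsto_nhdsWithin_iff.2 ⟨?_, .of_forall fun n => (hs n).1.le⟩
    refine tendsto_of_tendsto_of_tendsto_of_le_of_le tendsto_const_nhds ?_
      (fun n => (hs n).1.le) (fun n => (hs n).2.le)
    simpa using tendsto_const_nhds.add (tendsto_one_div_add_atTop_nhds_zero_nat (𝕜 := ℝ))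
  have hsub : {ω | X t ω ∈ U} ⊆ ⋃ n : ℕ, {ω | ∀ k ≥ n, X (s k) ω ∈ U} := fun ω hω => by
    have h1 := ((hX.rightCont ω t).tendsto.comp hlim).eventually (hU.mem_nhds hω)
    obtain ⟨n, hn⟩ := eventually_atTop.1 h1
    exact mem_iUnion.2 ⟨n, hn⟩
  refine (measure_mono hsub).trans ?_
  have hmono : Monotone fun n : ℕ => {ω | ∀ k ≥ n, X (s k) ω ∈ U} :=
    fun m n hmn ω (hω : ∀ k ≥ m, X (s k) ω ∈ U) k hk => hω k (hmn.trans hk)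
  rw [hmono.measure_iUnion]
  refine iSup_le fun n => (measure_mono ?_).trans (hsC n (ht.trans_lt (hs n).1))
  exact fun ω (hω : ∀ k ≥ n, X (s k) ω ∈ U) => hω n le_rfl

/-- Two independent copies of a Lévy process: coincidence at time `s` is independent of
separation of the increments over `[s, s + r]`. -/
lemma prod_measure_coincide_inter [IsProbabilityMeasure P] (hX : IsRightContLevy P X) {s r : ℝ}
    (hs : 0 ≤ s) (hr : 0 ≤ r) :
    (P.prod P) {y | X s y.1 = X s y.2 ∧ X (s + r) y.1 - X s y.1 ≠ X (s + r) y.2 - X s y.2} =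
      (P.prod P) {y | X s y.1 = X s y.2} * (P.prod P) {y | X r y.1 ≠ X r y.2} := by
  have hsr : s ≤ s + r := by linarith
  have hXs := hX.measurable s
  have hXr := hX.measurable r
  have hI := hX.measurable_increment s (s + r)
  have hind := hX.indepFun_increment hs hsr
  have m1 : MeasurableSet {y : Ω × Ω | X s y.1 = X s y.2} :=
    measurableSet_eq_fun (by fun_prop) (by fun_prop)
  have m3 : MeasurableSet {y : Ω × Ω | X (s + r) y.1 - X s y.1 ≠ X (s + r) y.2 - X s y.2} :=
    (measurableSet_eq_fun (hI.comp measurable_fst) (hI.comp measurable_snd)).compl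
  have e3 : (P.prod P) {y | X r y.1 ≠ X r y.2} =
      (P.prod P) {y | X (s + r) y.1 - X s y.1 ≠ X (s + r) y.2 - X s y.2} := by
    have hd : MeasurableSet {x : ℝ × ℝ | x.1 ≠ x.2} :=
      (measurableSet_eq_fun measurable_fst measurable_snd).compl
    have h := hX.stationary s (s + r) hs hsr
    rw [add_sub_cancel_left] at h
    have h1 := Measure.map_prod_map P P hXr hXr
    have h2 := Measure.map_prod_map P P hI hI
    rw [← h, h2] at h1
    have h3 := congrArg (fun m : Measure (ℝ × ℝ) => m {x | x.1 ≠ x.2}) h1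
    simp only [Measure.map_apply (hXr.prodMap hXr) hd, Measure.map_apply (hI.prodMap hI) hd] at h3
    exact h3.symm
  have f1 : Measurable fun a : ℝ => P {ω | a = X s ω} :=
    measurable_measure_prodMk_left (ν := P) (s := {y : ℝ × Ω | y.1 = X s y.2})
      (measurableSet_eq_fun measurable_fst (by fun_prop))
  have f2 : Measurable fun b : ℝ => P {ω | b ≠ X (s + r) ω - X s ω} :=
    measurable_measure_prodMk_left (ν := P) (s := {y : ℝ × Ω | y.1 ≠ X (s + r) y.2 - X s y.2})
      (measurableSet_eq_fun measurable_fst (hI.comp measurable_snd)).compl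
  refine (Measure.prod_apply (m1.inter m3)).trans ?_
  rw [e3, Measure.prod_apply m1, Measure.prod_apply m3]
  have hmul := lintegral_mul_eq_lintegral_mul_lintegral_of_indepFun (f1.comp hXs) (f2.comp hI)
    (hind.comp f1 f2)
  refine Eq.trans (lintegral_congr fun ω => ?_) hmul
  have h := hind.measure_inter_preimage_eq_mul {X s ω} {X (s + r) ω - X s ω}ᶜ
    (measurableSet_singleton _) (measurableSet_singleton _).compl
  simp only [Pi.mul_apply, Function.comp_apply]
  convert h using 2
  · ext ω'
    simp [eq_comm]
  · congr 1
    ext ω'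
    simp [eq_comm]
  · congr 1
    ext ω'
    simp [eq_comm]

/-- If a Lévy process hits `0` at time `t` with positive probability, then two independent copies
coincide with positive probability at each earlier time. -/
lemma prod_measure_coincide_ne_zero [IsProbabilityMeasure P] (hX : IsRightContLevy P X) {s t : ℝ}
    (hs : 0 ≤ s) (hst : s ≤ t) (h0 : P {ω | X t ω = 0} ≠ 0) :
    (P.prod P) {y | X s y.1 = X s y.2} ≠ 0 := by
  intro hD
  apply h0
  have hXs := hX.measurable s
  have m1 : MeasurableSet {y : Ω × Ω | X s y.1 = X s y.2} :=
    measurableSet_eq_fun (by fun_prop) (by fun_prop)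
  have hI := hX.measurable_increment s t
  have hatom : ∀ a, P {ω | X s ω = a} = 0 := by
    intro a
    have h1 := (Measure.measure_prod_null m1).1 hD
    by_contra hne
    obtain ⟨ω, hω, hω'⟩ := (frequently_ae_iff.2 hne).and_eventually h1 |>.exists
    apply hne
    rw [← hω]
    simpa [preimage, eq_comm] using hω'
  have hprod := (indepFun_iff_map_prod_eq_prod_map_map hXs.aemeasurable hI.aemeasurable).1
    (hX.indepFun_increment hs hst)
  have hm : MeasurableSet {x : ℝ × ℝ | x.1 = -x.2} :=
    measurableSet_eq_fun measurable_fst (by fun_prop)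
  have h2 : P {ω | X t ω = 0} = (P.map fun ω => (X s ω, X t ω - X s ω)) {x | x.1 = -x.2} := by
    rw [Measure.map_apply (hXs.prodMk hI) hm]
    congr 1
    ext ω
    simp only [mem_ofPred_eq, mem_preimage]
    constructor <;> intro h <;> linarith
  rw [h2, hprod, Measure.prod_apply_symm hm]
  refine (lintegral_congr fun b => ?_).trans lintegral_zero
  rw [Measure.map_apply hXs (measurable_prodMk_right hm)]
  exact hatom (-b)

/-- If a Lévy process hits `0` at some time with positive probability, then its law at small times
is concentrated near one atom. -/
lemma eventually_exists_measure_ne_lt [IsProbabilityMeasure P] (hX : IsRightContLevy P X) {t : ℝ}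
    (ht : 0 < t)
    (h0 : P {ω | X t ω = 0} ≠ 0) {ε : ENNReal} (hε : ε ≠ 0) :
    ∀ᶠ r in nhdsWithin (0 : ℝ) (Ioi 0), ∃ y, P {ω | X r ω ≠ y} < ε := by
  set D : ℝ → ENNReal := fun s => (P.prod P) {y | X s y.1 = X s y.2} with hD
  have hXm : Measurable fun y : ℝ × Ω => X y.1 y.2 := hX.measurable_uncurry
  have mZ : MeasurableSet {x : ℝ × (Ω × Ω) | X x.1 x.2.1 = X x.1 x.2.2} :=
    measurableSet_eq_fun (hXm.comp (by fun_prop : Measurable fun x : ℝ × (Ω × Ω) => (x.1, x.2.1)))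
      (hXm.comp (by fun_prop : Measurable fun x : ℝ × (Ω × Ω) => (x.1, x.2.2)))
  have mZr : ∀ r, MeasurableSet {x : ℝ × (Ω × Ω) | X (x.1 + r) x.2.1 = X (x.1 + r) x.2.2} :=
    fun r => (by fun_prop : Measurable fun x : ℝ × (Ω × Ω) => (x.1 + r, x.2)) mZ
  have hDm : Measurable D := measurable_measure_prodMk_left mZ
  set I := ∫⁻ s in Ioo 0 t, D s with hI
  have hIpos : I ≠ 0 := by
    refine ((setLIntegral_pos_iff hDm).2 ?_).ne'
    have hsub : Ioo 0 t ⊆ Function.support D := fun s hs =>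
      hX.prod_measure_coincide_ne_zero hs.1.le hs.2.le h0
    rw [inter_eq_right.2 hsub]
    simpa using ht
  set E : ℝ → Set (ℝ × (Ω × Ω)) := fun r => {x | X x.1 x.2.1 = X x.1 x.2.2} \
    {x | X (x.1 + r) x.2.1 = X (x.1 + r) x.2.2} with hE
  have mE : ∀ r, MeasurableSet (E r) := fun r => mZ.diff (mZr r)
  set μ := volume.restrict (Ioo (0 : ℝ) t) with hμ
  have hbound : ∀ r, 0 ≤ r → I * (P.prod P) {y | X r y.1 ≠ X r y.2} ≤
      ∫⁻ y, μ ((fun s => (s, y)) ⁻¹' E r) ∂(P.prod P) := by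
    intro r hr
    rw [← Measure.prod_apply_symm (mE r), Measure.prod_apply (mE r), hI,
      ← lintegral_mul_const _ hDm]
    refine setLIntegral_mono (measurable_measure_prodMk_left (mE r)) fun s hs => ?_
    rw [hD, ← hX.prod_measure_coincide_inter hs.1.le hr]
    refine measure_mono fun y hy => ⟨hy.1, fun h => hy.2 ?_⟩
    have h : X (s + r) y.1 = X (s + r) y.2 := h
    rw [h, hy.1]
  have hlim : Tendsto (fun r => ∫⁻ y, μ ((fun s => (s, y)) ⁻¹' E r) ∂(P.prod P))
      (nhdsWithin 0 (Ioi 0)) (nhds 0) := by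
    rw [show (0 : ENNReal) = ∫⁻ _, 0 ∂(P.prod P) by simp]
    refine tendsto_lintegral_filter_of_dominated_convergence (fun _ => ENNReal.ofReal t)
      (.of_forall fun r => measurable_measure_prodMk_right (mE r))
      (.of_forall fun r => .of_forall fun y => ?_) (by simp) (.of_forall fun y => ?_)
    · refine (measure_mono (subset_univ _)).trans ?_
      simp [hμ]
    · have mZy : MeasurableSet ({s | X s y.1 = X s y.2} ∩ Ioo 0 t) :=
        (measurable_prodMk_right (y := y) mZ).inter measurableSet_Ioo
      have hfin : volume ({s | X s y.1 = X s y.2} ∩ Ioo 0 t) ≠ ⊤ :=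
        measure_ne_top_of_subset inter_subset_right (by simp)
      refine tendsto_of_tendsto_of_tendsto_of_le_of_le tendsto_const_nhds
        (tendsto_volume_diff_preimage_add mZy hfin) (fun _ => zero_le) fun r => ?_
      rw [hμ, Measure.restrict_apply (measurable_prodMk_right (mE r))]
      refine measure_mono fun s hs => ⟨⟨hs.1.1, hs.2⟩, fun h => hs.1.2 h.1⟩
  have hev := hlim.eventually (gt_mem_nhds (pos_iff_ne_zero.2 (mul_ne_zero hIpos hε)))
  filter_upwards [hev, self_mem_nhdsWithin] with r hr hr0
  have hr0 : 0 < r := hr0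
  have hlt : (P.prod P) {y | X r y.1 ≠ X r y.2} < ε :=
    lt_of_mul_lt_mul_left' ((hbound r hr0.le).trans_lt hr)
  have hXr := hX.measurable r
  have m2 : MeasurableSet {y : Ω × Ω | X r y.1 ≠ X r y.2} :=
    (measurableSet_eq_fun (f := fun y : Ω × Ω => X r y.1) (by fun_prop) (by fun_prop)).compl
  rw [Measure.prod_apply m2] at hlt
  obtain ⟨ω, hω⟩ := exists_le_lintegral (μ := P)
    (measurable_measure_prodMk_left (ν := P) m2).aemeasurable
  refine ⟨X r ω, lt_of_le_of_lt (le_of_eq ?_) (hω.trans_lt hlt)⟩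
  congr 1
  ext ω'
  simp [eq_comm]

lemma measureReal_increment (hX : IsRightContLevy P X) {s t : ℝ} (hs : 0 ≤ s) (hst : s ≤ t)
    {B : Set ℝ} (hB : MeasurableSet B) :
    P.real {ω | X t ω - X s ω ∈ B} = P.real {ω | X (t - s) ω ∈ B} :=
  congrArg ENNReal.toReal (hX.measure_increment hs hst hB)

variable [IsProbabilityMeasure P]

lemma measurable_positivity (hX : IsRightContLevy P X) :
    Measurable fun t => P.real {ω | 0 < X t ω} :=
  (measurable_measure_prodMk_left (ν := P)
    (hX.measurable_uncurry measurableSet_Ioi)).ennreal_toReal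

lemma measureReal_preimage_le_of_isOpen (hX : IsRightContLevy P X) {U : Set ℝ} (hU : IsOpen U)
    {C : ℝ} (hC : 0 ≤ C) (h : ∀ᵐ s, 0 < s → P.real {ω | X s ω ∈ U} ≤ C) {t : ℝ} (ht : 0 ≤ t) :
    P.real {ω | X t ω ∈ U} ≤ C := by
  refine ENNReal.toReal_le_of_le_ofReal hC (hX.measure_preimage_le_of_isOpen hU ?_ ht)
  filter_upwards [h] with s hs hs0
  rw [← ofReal_measureReal]
  exact ENNReal.ofReal_le_ofReal (hs hs0)

lemma measureReal_nonpos (hX : IsRightContLevy P X) (t : ℝ) :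
    P.real {ω | X t ω ≤ 0} = 1 - P.real {ω | 0 < X t ω} := by
  refine Eq.trans ?_ (probReal_compl_eq_one_sub (μ := P)
    (hX.measurable t (measurableSet_Ioi (a := (0 : ℝ)))))
  congr 1
  ext ω
  simp

/-- If `X r` nearly concentrates at a point while neither `X r > 0` nor `X r ≤ 0` is that
unlikely, then the point is `0`. -/
lemma measureReal_ne_zero_lt (hX : IsRightContLevy P X) {c : ℝ} {r ε : ℝ}
    (hr : P.real {ω | 0 < X r ω} = c) (hεc : ε ≤ c) (hεc' : ε ≤ 1 - c) {y : ℝ}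
    (hy : P.real {ω | X r ω ≠ y} < ε) : P.real {ω | X r ω ≠ 0} < ε := by
  rcases lt_trichotomy y 0 with hy0 | rfl | hy0
  · have h1 : P.real {ω | 0 < X r ω} ≤ P.real {ω | X r ω ≠ y} :=
      measureReal_mono fun ω (hω : 0 < X r ω) => (hy0.trans hω).ne'
    linarith
  · exact hy
  · have h1 : P.real {ω | X r ω ≤ 0} ≤ P.real {ω | X r ω ≠ y} :=
      measureReal_mono fun ω (hω : X r ω ≤ 0) => (hω.trans_lt hy0).ne
    rw [hX.measureReal_nonpos, hr] at h1
    linarith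

lemma le_positivity_of_measure_zero_ne_zero (hX : IsRightContLevy P X) {c : ℝ} (hc0 : 0 < c)
    (hc1 : c < 1) (h : ∀ᵐ t, 0 < t → P.real {ω | 0 < X t ω} = c) {t : ℝ} (ht : 0 < t)
    (h0 : P {ω | X t ω = 0} ≠ 0) : c ≤ P.real {ω | 0 < X t ω} := by
  refine le_of_forall_pos_le_add fun η hη => ?_
  set ε := min (min c (1 - c)) η with hε
  have hε0 : 0 < ε := lt_min (lt_min hc0 (by linarith)) hη
  have hev := hX.eventually_exists_measure_ne_lt ht h0 (ENNReal.ofReal_pos.2 hε0).ne'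
  obtain ⟨δ, hδ, hδ'⟩ := mem_nhdsGT_iff_exists_Ioo_subset.1 hev
  have hshift := (measurePreserving_add_left volume t).quasiMeasurePreserving.ae h
  obtain ⟨r, hr, hr1, hr2⟩ := exists_mem_Ioo_of_ae (h.and hshift) (show (0 : ℝ) < δ from hδ)
  obtain ⟨y, hy⟩ := hδ' hr
  have hy' : P.real {ω | X r ω ≠ y} < ε :=
    (ENNReal.lt_ofReal_iff_toReal_lt (measure_ne_top _ _)).1 hy
  have hlt := hX.measureReal_ne_zero_lt (hr1 hr.1) ((min_le_left _ _).trans (min_le_left _ _))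
    ((min_le_left _ _).trans (min_le_right _ _)) hy'
  have hinc := hX.measureReal_increment ht.le (by linarith [hr.1] : t ≤ t + r)
    (measurableSet_singleton (0 : ℝ)).compl
  rw [add_sub_cancel_left] at hinc
  have hle : P.real {ω | 0 < X (t + r) ω} ≤
      P.real {ω | 0 < X t ω} + P.real {ω | X (t + r) ω - X t ω ∈ ({0} : Set ℝ)ᶜ} := by
    refine (measureReal_mono fun ω (hω : 0 < X (t + r) ω) => ?_).trans (measureReal_union_le _ _)
    by_cases hz : X (t + r) ω - X t ω = 0
    · exact Or.inl (show 0 < X t ω by linarith)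
    · exact Or.inr hz
  rw [hr2 (by linarith [hr.1]), hinc] at hle
  have : P.real {ω | X r ω ∈ ({0} : Set ℝ)ᶜ} < ε := hlt
  have := min_le_right (min c (1 - c)) η
  linarith

/-- An a.e. constant positivity function is constant. -/
lemma positivity_eq_of_ae (hX : IsRightContLevy P X) {c : ℝ} (hc : c ∈ Icc (0 : ℝ) 1)
    (h : ∀ᵐ t, 0 < t → P.real {ω | 0 < X t ω} = c) {t : ℝ} (ht : 0 < t) :
    P.real {ω | 0 < X t ω} = c := by
  refine le_antisymm (hX.measureReal_preimage_le_of_isOpen isOpen_Ioi hc.1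
    (h.mono fun s hs hs0 => (hs hs0).le) ht.le) ?_
  rcases hc.1.eq_or_lt with rfl | hc0
  · exact measureReal_nonneg
  rcases hc.2.eq_or_lt with rfl | hc1
  · have hrefl := (volume.measurePreserving_sub_left t).quasiMeasurePreserving.ae h
    obtain ⟨s, hs, hs1, hs2⟩ := exists_mem_Ioo_of_ae (h.and hrefl) ht
    have hinc := hX.measureReal_increment hs.1.le hs.2.le (measurableSet_Iic (a := (0 : ℝ)))
    have e1 := hX.measureReal_nonpos s
    have e2 := hX.measureReal_nonpos (t - s)
    have e3 := hX.measureReal_nonpos t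
    have hle : P.real {ω | X t ω ≤ 0} ≤
        P.real {ω | X s ω ≤ 0} + P.real {ω | X t ω - X s ω ∈ Iic (0 : ℝ)} := by
      refine (measureReal_mono fun ω (hω : X t ω ≤ 0) => ?_).trans (measureReal_union_le _ _)
      by_cases hz : X s ω ≤ 0
      · exact Or.inl hz
      · exact Or.inr (show X t ω - X s ω ≤ 0 by linarith)
    rw [hs1 hs.1] at e1
    rw [hs2 (by linarith [hs.2])] at e2
    rw [hinc] at hle
    have e2' : P.real {ω | X (t - s) ω ∈ Iic (0 : ℝ)} = 1 - 1 := e2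
    linarith
  by_cases h0 : P {ω | X t ω = 0} = 0
  · have hneg : P.real {ω | X t ω ∈ Iio (0 : ℝ)} ≤ 1 - c := by
      refine hX.measureReal_preimage_le_of_isOpen isOpen_Iio (by linarith) ?_ ht.le
      filter_upwards [h] with s hs hs0
      rw [← hs hs0, ← hX.measureReal_nonpos]
      exact measureReal_mono fun ω (hω : X s ω < 0) => hω.le
    have hle : P.real {ω | X t ω ≤ 0} ≤
        P.real {ω | X t ω ∈ Iio (0 : ℝ)} + P.real {ω | X t ω = 0} := by
      refine (measureReal_mono fun ω (hω : X t ω ≤ 0) => ?_).trans (measureReal_union_le _ _)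
      exact hω.lt_or_eq
    have h0' : P.real {ω | X t ω = 0} = 0 := by simp [measureReal_def, h0]
    rw [hX.measureReal_nonpos, h0'] at hle
    linarith
  · exact hX.le_positivity_of_measure_zero_ne_zero hc0 hc1 h ht h0

end IsRightContLevy

/-- A Lévy process has constant positivity `c` if and only if the double Laplace
transform of its positive sojourn time equals `1/(q (1 + λ/q)^c)` for all `q, λ > 0`. -/
theorem constant_positivity_iff_double_laplace (P : Measure Ω) [IsProbabilityMeasure P]
    (X : ℝ → Ω → ℝ) (hX : IsLevyProcess P X) (c : ℝ) (hc : c ∈ Set.Icc (0:ℝ) 1) :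
    (∀ t : ℝ, 0 < t → P {ω | 0 < X t ω} = ENNReal.ofReal c) ↔
    (∀ q lam : ℝ, 0 < q → 0 < lam →
      ∫ t in Set.Ioi (0:ℝ), Real.exp (-q * t) * ∫ ω, Real.exp (-lam * sojourn X t ω) ∂P
        = 1 / (q * (1 + lam / q) ^ c)) := by
  obtain ⟨Y, hY, hYX⟩ := hX.exists_rightCont
  have hpos : ∀ t, 0 < t → P {ω | 0 < X t ω} = P {ω | 0 < Y t ω} := fun t ht => by
    refine measure_congr ?_
    filter_upwards [hYX] with ω hω
    exact congrArg (fun x : ℝ => 0 < x) (hω t ht.le).symm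
  have hlap : ∀ q lam : ℝ,
      ∫ t in Set.Ioi (0:ℝ), Real.exp (-q * t) * ∫ ω, Real.exp (-lam * sojourn X t ω) ∂P =
      ∫ t in Set.Ioi (0:ℝ), Real.exp (-q * t) * ∫ ω, Real.exp (-lam * sojourn Y t ω) ∂P :=
    fun q lam => by
    refine setIntegral_congr_fun measurableSet_Ioi fun t (ht : 0 < t) => ?_
    congr 1
    refine integral_congr_ae ?_
    filter_upwards [hYX] with ω hω
    rw [sojourn_eq_of_eqOn ht.le fun s hs => (hω s hs.1).symm]
  have hrhs : ∀ q lam : ℝ, 0 < q → 0 < lam → 1 / (q * (1 + lam / q) ^ c) =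
      1 / q * Real.exp (-(c * ∫ t in Ioi (0 : ℝ), frullaniWeight q lam t)) := fun q lam hq hl => by
    rw [integral_frullaniWeight hq hl.le, Real.rpow_def_of_pos (by positivity), Real.exp_neg,
      mul_comm c]
    field_simp
  have hreal : ∀ t, 0 < t → (P {ω | 0 < X t ω} = ENNReal.ofReal c ↔
      P.real {ω | 0 < Y t ω} = c) := fun t ht => by
    rw [hpos t ht, ← ENNReal.ofReal_toReal (measure_ne_top P {ω | 0 < Y t ω}),
      ENNReal.ofReal_eq_ofReal_iff ENNReal.toReal_nonneg hc.1]
    rfl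
  constructor
  · intro h q lam hq hl
    rw [hlap, hY.double_laplace_sojourn hq hl.le, hrhs q lam hq hl, ← integral_const_mul]
    congr 3
    refine setIntegral_congr_fun measurableSet_Ioi fun t (ht : 0 < t) => ?_
    rw [(hreal t ht).1 (h t ht), mul_comm]
  · intro h t ht
    rw [hreal t ht]
    refine hY.positivity_eq_of_ae hc ?_ ht
    refine (ae_restrict_iff' measurableSet_Ioi).1 ?_
    refine ae_eq_const_of_integral_frullaniWeight hY.measurable_positivity
      (fun _ => measureReal_nonneg) (fun _ => measureReal_le_one) hc.1 fun q lam hq hl => ?_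
    have h1 := h q lam hq hl
    rw [hlap, hY.double_laplace_sojourn hq hl.le, hrhs q lam hq hl] at h1
    exact neg_injective (Real.exp_injective (mul_left_cancel₀ (by positivity) h1))

end
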